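/- arXiv:1910.02832 — 3 statements merged into one kernel-verified Lean document; each statement's English description precedes it below -/
import Mathlib

section
/- For every positive integer a and every real σ > 0, L(a; σ) ≥ σ · (2τ(a) − W(a; σ)). -/
open Real MeasureTheory
open scoped Classical

/-- number of residues n mod d with F(n) ≡ 0 (mod d) -/
noncomputable def polyRho (F : Polynomial ℤ) (d : ℕ) : ℕ :=
  ((Finset.range d).filter (fun n => (d : ℤ) ∣ F.eval (n : ℤ))).card

/-- H_F(x,y,z): number of positive n ≤ x with F(n) having a divisor in (y,z] -/
noncomputable def polyH (F : Polynomial ℤ) (x y z : ℝ) : ℕ :=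
  {n : ℕ | 0 < n ∧ (n : ℝ) ≤ x ∧
    ∃ d : ℕ, 0 < d ∧ (d : ℤ) ∣ F.eval (n : ℤ) ∧ y < (d : ℝ) ∧ (d : ℝ) ≤ z}.ncard

/-- H(x,y,z): number of positive n ≤ x having a divisor in (y,z] -/
noncomputable def Hdiv (x y z : ℝ) : ℕ :=
  {n : ℕ | 0 < n ∧ (n : ℝ) ≤ x ∧
    ∃ d : ℕ, 0 < d ∧ d ∣ n ∧ y < (d : ℝ) ∧ (d : ℝ) ≤ z}.ncard

/-- L(a;σ) -/
noncomputable def Lfun (a : ℕ) (σ : ℝ) : ℝ :=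
  (volume {x : ℝ | ∃ d : ℕ, d ∣ a ∧ Real.exp x < (d : ℝ) ∧ (d : ℝ) ≤ Real.exp (x + σ)}).toReal

/-- W(a;σ): ordered pairs of divisors near each other -/
noncomputable def Wfun (a : ℕ) (σ : ℝ) : ℕ :=
  {p : ℕ × ℕ | p.1 ∣ a ∧ p.2 ∣ a ∧ |Real.log ((p.1 : ℝ) / (p.2 : ℝ))| ≤ σ}.ncard

/-- 𝒫(s,t): squarefree integers with all prime factors in (s,t] -/
def Psf (s t : ℝ) : Set ℕ :=
  {a : ℕ | 0 < a ∧ Squarefree a ∧ ∀ p : ℕ, p.Prime → p ∣ a → s < (p : ℝ) ∧ (p : ℝ) ≤ t}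

/-- φ_F(n) = n ∏_{p|n} (1 - ρ(p)/p) -/
noncomputable def polyPhi (F : Polynomial ℤ) (n : ℕ) : ℝ :=
  (n : ℝ) * ∏ p ∈ n.primeFactors, (1 - (polyRho F p : ℝ) / p)

/-- P⁺(n): largest prime factor, P⁺(1)=0 -/
def Pplus (n : ℕ) : ℕ := n.primeFactors.sup id

/-- h(n;X): least prime q with ∏_{p^ν ∥ n, p ≤ q} p^ν > √X -/
noncomputable def hfun (n : ℕ) (X : ℝ) : ℕ :=
  sInf {q : ℕ | q.Prime ∧
    Real.sqrt X < ∏ p ∈ n.primeFactors.filter (fun p => p ≤ q), (p : ℝ) ^ (n.factorization p)}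


/-- The divisors of `a` within logarithmic distance `σ` of `d`. -/
noncomputable def closeDivisors (a : ℕ) (σ : ℝ) (d : ℕ) : Finset ℕ :=
  a.divisors.filter (fun e => |Real.log ((d : ℝ) / (e : ℝ))| ≤ σ)

lemma Wfun_eq_sum_card_closeDivisors {a : ℕ} (ha : a ≠ 0) (σ : ℝ) :
    Wfun a σ = ∑ d ∈ a.divisors, (closeDivisors a σ d).card := by
  rw [← Finset.card_sigma, Wfun, ← Set.ncard_coe_finset]
  refine Set.ncard_congr (fun p _ => (⟨p.1, p.2⟩ : (_ : ℕ) × ℕ)) ?_ ?_ ?_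
  · rintro ⟨d, e⟩ ⟨h1, h2, h3⟩
    simpa [closeDivisors, ha] using ⟨h1, h2, h3⟩
  · rintro ⟨d, e⟩ ⟨d', e'⟩ _ _ h
    simpa using h
  · rintro ⟨d, e⟩ h
    simp only [closeDivisors, Finset.coe_sigma, Set.mem_sigma_iff, Finset.mem_coe,
      Finset.mem_filter, Nat.mem_divisors] at h
    exact ⟨(d, e), ⟨h.1.1, h.2.1.1, h.2.2⟩, rfl⟩

lemma self_mem_closeDivisors {a : ℕ} {σ : ℝ} (hσ : 0 ≤ σ) {d : ℕ} (hd : d ∈ a.divisors) :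
    d ∈ closeDivisors a σ d := by
  have : (d : ℝ) ≠ 0 := by exact_mod_cast (Nat.pos_of_mem_divisors hd).ne'
  simp [closeDivisors, hd, div_self this, hσ, -Nat.mem_divisors]

/-- `2τ(a) - W(a;σ)` is at most the number of divisors isolated at scale `σ`. -/
lemma two_mul_card_divisors_sub_Wfun_le {a : ℕ} (ha : a ≠ 0) {σ : ℝ} (hσ : 0 ≤ σ) :
    2 * (a.divisors.card : ℝ) - (Wfun a σ : ℝ) ≤
      ((a.divisors.filter (fun d => (closeDivisors a σ d).card = 1)).card : ℝ) := by
  have h : 2 * a.divisors.card ≤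
      (a.divisors.filter (fun d => (closeDivisors a σ d).card = 1)).card + Wfun a σ := by
    rw [Wfun_eq_sum_card_closeDivisors ha, Finset.card_filter, ← Finset.sum_add_distrib,
      mul_comm, ← smul_eq_mul]
    refine Finset.card_nsmul_le_sum _ _ _ fun d hd => ?_
    have := Finset.card_pos.mpr ⟨d, self_mem_closeDivisors hσ hd⟩
    split_ifs <;> omega
  have h' : (2 * (a.divisors.card : ℝ)) ≤
      ((a.divisors.filter (fun d => (closeDivisors a σ d).card = 1)).card : ℝ) + Wfun a σ := by
    exact_mod_cast h
  linarith

lemma setOf_exists_dvd_eq_biUnion_Ico {a : ℕ} (ha : a ≠ 0) (σ : ℝ) :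
    {x : ℝ | ∃ d : ℕ, d ∣ a ∧ Real.exp x < (d : ℝ) ∧ (d : ℝ) ≤ Real.exp (x + σ)} =
      ⋃ d ∈ a.divisors, Set.Ico (Real.log d - σ) (Real.log d) := by
  ext x
  simp only [Set.mem_ofPred_eq, Set.mem_iUnion, exists_prop, Nat.mem_divisors, Set.mem_Ico]
  refine exists_congr fun d => ?_
  rw [and_assoc]
  refine and_congr_right fun hd => ?_
  have hpos : (0 : ℝ) < d := by exact_mod_cast Nat.pos_of_dvd_of_pos hd (Nat.pos_of_ne_zero ha)
  rw [← Real.lt_log_iff_exp_lt hpos, ← Real.log_le_iff_le_exp hpos, sub_le_iff_le_add]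
  tauto

lemma pairwiseDisjoint_Ico_log (a : ℕ) (σ : ℝ) :
    (a.divisors.filter (fun d => (closeDivisors a σ d).card = 1) : Set ℕ).PairwiseDisjoint
      (fun d : ℕ => Set.Ico (Real.log d - σ) (Real.log d)) := by
  intro d hd e he hne
  simp only [Finset.coe_filter, Set.mem_ofPred_eq] at hd he
  refine Set.disjoint_left.mpr fun x hx hx' => hne ?_
  have hσ : 0 ≤ σ := by linarith [hx.1, hx.2]
  have hd0 : (d : ℝ) ≠ 0 := by exact_mod_cast (Nat.pos_of_mem_divisors hd.1).ne'
  have he0 : (e : ℝ) ≠ 0 := by exact_mod_cast (Nat.pos_of_mem_divisors he.1).ne'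
  refine Finset.card_le_one.mp hd.2.le d (self_mem_closeDivisors hσ hd.1) e ?_
  refine Finset.mem_filter.mpr ⟨he.1, ?_⟩
  rw [Real.log_div hd0 he0, abs_le]
  constructor <;> linarith [hx.1, hx.2, hx'.1, hx'.2]

theorem stmt4 (a : ℕ) (ha : 0 < a) (σ : ℝ) (hσ : 0 < σ) :
    σ * (2 * (a.divisors.card : ℝ) - (Wfun a σ : ℝ)) ≤ Lfun a σ := by
  refine (mul_le_mul_of_nonneg_left
    (two_mul_card_divisors_sub_Wfun_le ha.ne' hσ.le) hσ.le).trans ?_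
  rw [Lfun, setOf_exists_dvd_eq_biUnion_Ico ha.ne']
  set S := a.divisors.filter (fun d => (closeDivisors a σ d).card = 1) with hS
  have hfin : volume (⋃ d ∈ a.divisors, Set.Ico (Real.log d - σ) (Real.log d)) ≠ ⊤ :=
    (measure_biUnion_lt_top a.divisors.finite_toSet fun d _ => measure_Ico_lt_top).ne
  have hvol : volume (⋃ d ∈ S, Set.Ico (Real.log d - σ) (Real.log d)) =
      S.card * ENNReal.ofReal σ := by
    rw [measure_biUnion_finset (pairwiseDisjoint_Ico_log a σ) fun _ _ => measurableSet_Ico]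
    simp [hS]
  calc σ * (S.card : ℝ)
      = (volume (⋃ d ∈ S, Set.Ico (Real.log d - σ) (Real.log d))).toReal := by
        rw [hvol, ENNReal.toReal_mul, ENNReal.toReal_natCast, ENNReal.toReal_ofReal hσ.le, mul_comm]
    _ ≤ _ := ENNReal.toReal_mono hfin <| measure_mono <|
        Set.biUnion_subset_biUnion_left fun d hd => (Finset.mem_filter.mp hd).1
end

section
/- Let F ∈ ℤ[t] be an irreducible polynomial of degree g ≥ 2. There exists a constant K > 0, depending only on F, such that for all reals r, s, t with 2 ≤ r < s < t and every real η > 0: ∑_{a ∈ 𝒫(r,t)} L(a; η) ρ(a)/a ≤ K · (log t / log s)² · ∑_{a ∈ 𝒫(r,s)} L(a; η) ρ(a)/a. -/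
open Real MeasureTheory
open scoped Classical

/-- The sum of `f` over all products of subsets of `A`. -/
noncomputable def subsetProdSum (A : Finset ℕ) (f : ℕ → ℝ) : ℝ :=
  ∑ B ∈ A.powerset, f (∏ p ∈ B, p)

theorem subsetProdSum_nonneg (A : Finset ℕ) {f : ℕ → ℝ} (hf : ∀ n, 0 ≤ f n) :
    0 ≤ subsetProdSum A f :=
  Finset.sum_nonneg fun _ _ => hf _

/-- The primes in the half-open interval `(r, t]`. -/
noncomputable def primesIoc (r t : ℝ) : Finset ℕ :=
  (Finset.range (⌊t⌋₊ + 1)).filter fun p => p.Prime ∧ r < p ∧ (p : ℝ) ≤ t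

theorem mem_primesIoc {r t : ℝ} {p : ℕ} :
    p ∈ primesIoc r t ↔ p.Prime ∧ r < p ∧ (p : ℝ) ≤ t := by
  simp only [primesIoc, Finset.mem_filter, Finset.mem_range, and_iff_right_iff_imp]
  rintro ⟨-, -, h⟩
  exact Nat.lt_succ_of_le (Nat.le_floor h)

theorem primesIoc_union {r s t : ℝ} (hrs : r ≤ s) (hst : s ≤ t) :
    primesIoc r s ∪ primesIoc s t = primesIoc r t := by
  ext p
  simp only [Finset.mem_union, mem_primesIoc]
  constructor
  · rintro (⟨hp, h1, h2⟩ | ⟨hp, h1, h2⟩)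
    · exact ⟨hp, h1, h2.trans hst⟩
    · exact ⟨hp, hrs.trans_lt h1, h2⟩
  · rintro ⟨hp, h1, h2⟩
    rcases le_or_gt (p : ℝ) s with h | h
    · exact Or.inl ⟨hp, h1, h⟩
    · exact Or.inr ⟨hp, h, h2⟩

theorem disjoint_primesIoc (r s t : ℝ) : Disjoint (primesIoc r s) (primesIoc s t) := by
  rw [Finset.disjoint_left]
  intro p hp hp'
  exact absurd (mem_primesIoc.1 hp).2.2 (not_le.2 (mem_primesIoc.1 hp').2.1)

theorem Psf_eq_image (r t : ℝ) :
    Psf r t = ((primesIoc r t).powerset.image fun B => ∏ p ∈ B, p : Finset ℕ) := by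
  ext a
  simp only [Psf, Set.mem_ofPred_eq, Finset.coe_image, Set.mem_image, Finset.mem_coe,
    Finset.mem_powerset]
  constructor
  · rintro ⟨ha, hsq, hp⟩
    refine ⟨a.primeFactors, fun p h => ?_, Nat.prod_primeFactors_of_squarefree hsq⟩
    have := Nat.mem_primeFactors.1 h
    exact mem_primesIoc.2 ⟨this.1, hp p this.1 this.2.1⟩
  · rintro ⟨B, hB, rfl⟩
    have hprime : ∀ p ∈ B, p.Prime := fun p h => (mem_primesIoc.1 (hB h)).1
    refine ⟨Finset.prod_pos fun p h => (hprime p h).pos, ?_, fun p hp hdvd => ?_⟩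
    · refine Finset.squarefree_prod_of_pairwise_isCoprime ?_ fun p h => (hprime p h).squarefree
      intro p hp q hq hpq
      exact Nat.coprime_iff_isRelPrime.1 ((Nat.coprime_primes (hprime p hp) (hprime q hq)).2 hpq)
    · have : p ∈ (∏ p ∈ B, p).primeFactors :=
        Nat.mem_primeFactors.2 ⟨hp, hdvd, (Finset.prod_pos fun p h => (hprime p h).pos).ne'⟩
      rw [Nat.primeFactors_prod hprime] at this
      exact (mem_primesIoc.1 (hB this)).2

theorem tsum_Psf (r t : ℝ) (f : ℕ → ℝ) :
    ∑' a : Psf r t, f a = subsetProdSum (primesIoc r t) f := by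
  rw [Psf_eq_image]
  refine (Finset.tsum_subtype _ f).trans ?_
  rw [Finset.sum_image, subsetProdSum]
  intro B hB C hC hBC
  have h : ∀ D ∈ (primesIoc r t).powerset, (∏ p ∈ D, p).primeFactors = D := fun D hD =>
    Nat.primeFactors_prod fun p hp => (mem_primesIoc.1 (Finset.mem_powerset.1 hD hp)).1
  rw [← h B hB, ← h C hC]
  exact congrArg _ hBC

theorem subsetProdSum_union_le {f g : ℕ → ℝ} (hg : ∀ n, 0 ≤ g n)
    (hfg : ∀ p m : ℕ, p.Prime → 0 < m → Nat.Coprime p m → f (p * m) ≤ g p * f m)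
    (A B : Finset ℕ) (hA : ∀ p ∈ A, p.Prime) (hB : ∀ p ∈ B, p.Prime) (hAB : Disjoint A B) :
    subsetProdSum (A ∪ B) f ≤ (∏ p ∈ B, (1 + g p)) * subsetProdSum A f := by
  induction B using Finset.induction_on with
  | empty => simp
  | insert q B hq ih =>
    rw [Finset.disjoint_insert_right] at hAB
    have hB' : ∀ p ∈ B, p.Prime := fun p hp => hB p (Finset.mem_insert_of_mem hp)
    have hqp : q.Prime := hB q (Finset.mem_insert_self _ _)
    have hqAB : q ∉ A ∪ B := by simp [hAB.1, hq]
    have hAB' : ∀ p ∈ A ∪ B, p.Prime := fun p hp =>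
      (Finset.mem_union.1 hp).elim (hA p) (hB' p)
    rw [Finset.union_insert, Finset.prod_insert hq, subsetProdSum,
      Finset.sum_powerset_insert hqAB, mul_assoc]
    refine le_trans ?_ (mul_le_mul_of_nonneg_left (ih hB' hAB.2) (add_nonneg zero_le_one (hg q)))
    rw [add_mul, one_mul, subsetProdSum, Finset.mul_sum]
    refine add_le_add le_rfl (Finset.sum_le_sum fun C hC => ?_)
    have hC' := Finset.mem_powerset.1 hC
    rw [Finset.prod_insert fun h => hqAB (hC' h)]
    refine hfg _ _ hqp (Finset.prod_pos fun p h => (hAB' p (hC' h)).pos) ?_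
    refine Nat.Coprime.prod_right fun p h => ?_
    exact (Nat.coprime_primes hqp (hAB' p (hC' h))).2 fun h' => hqAB (h' ▸ hC' h)

theorem subsetProdSum_union_le_exp {f g : ℕ → ℝ} (hf : ∀ n, 0 ≤ f n) (hg : ∀ n, 0 ≤ g n)
    (hfg : ∀ p m : ℕ, p.Prime → 0 < m → Nat.Coprime p m → f (p * m) ≤ g p * f m)
    (A B : Finset ℕ) (hA : ∀ p ∈ A, p.Prime) (hB : ∀ p ∈ B, p.Prime) (hAB : Disjoint A B) :
    subsetProdSum (A ∪ B) f ≤ Real.exp (∑ p ∈ B, g p) * subsetProdSum A f := by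
  refine (subsetProdSum_union_le hg hfg A B hA hB hAB).trans ?_
  refine mul_le_mul_of_nonneg_right ?_ (subsetProdSum_nonneg A hf)
  rw [Real.exp_sum]
  refine Finset.prod_le_prod (fun p _ => add_nonneg zero_le_one (hg p)) fun p _ => ?_
  rw [add_comm]
  exact Real.add_one_le_exp _

theorem polyRho_eq_card_filter (F : Polynomial ℤ) (d : ℕ) :
    polyRho F d = ((Finset.range d).filter fun n : ℕ => (d : ℤ) ∣ F.eval (n : ℤ)).card := by
  have h : (do let a ← Finset.range d; pure (a : ℤ) : Finset ℤ) =
      (Finset.range d).image (fun n : ℕ => (n : ℤ)) := by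
    ext
    simp [Finset.bind_def, Finset.pure_def, Finset.sup_singleton_apply]
  unfold polyRho
  rw [h, Finset.filter_image, Finset.card_image_of_injective _ Nat.cast_injective]

theorem polyRho_mul_le (F : Polynomial ℤ) {m n : ℕ} (hm : 0 < m) (hn : 0 < n)
    (h : Nat.Coprime m n) : polyRho F (m * n) ≤ polyRho F m * polyRho F n := by
  rw [polyRho_eq_card_filter, polyRho_eq_card_filter, polyRho_eq_card_filter,
    ← Finset.card_product]
  have key : ∀ d e k : ℕ, d ∣ e → (e : ℤ) ∣ F.eval (k : ℤ) →
      (d : ℤ) ∣ F.eval ((k % d : ℕ) : ℤ) := by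
    intro d e k hde hk
    have h1 : (d : ℤ) ∣ F.eval (k : ℤ) := (Int.natCast_dvd_natCast.2 hde).trans hk
    have h2 : (d : ℤ) ∣ F.eval (k : ℤ) - F.eval ((k % d : ℕ) : ℤ) := by
      refine dvd_trans ?_ (Polynomial.sub_dvd_eval_sub (k : ℤ) ((k % d : ℕ) : ℤ) F)
      push_cast
      exact Int.dvd_self_sub_emod
    exact (dvd_sub_right h1).1 h2
  refine Finset.card_le_card_of_injOn (fun k => (k % m, k % n)) ?_ ?_
  · intro k hk
    simp only [Finset.coe_filter, Finset.mem_range, Set.mem_ofPred_eq] at hk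
    simp only [Finset.coe_product, Set.mem_prod, Finset.coe_filter, Finset.mem_range,
      Set.mem_ofPred_eq]
    exact ⟨⟨Nat.mod_lt _ hm, key _ _ _ (dvd_mul_right _ _) hk.2⟩,
      ⟨Nat.mod_lt _ hn, key _ _ _ (dvd_mul_left _ _) hk.2⟩⟩
  · intro k hk l hl hkl
    simp only [Finset.coe_filter, Finset.mem_range, Set.mem_ofPred_eq] at hk hl
    simp only [Prod.mk.injEq] at hkl
    have : k ≡ l [MOD m * n] := (Nat.modEq_and_modEq_iff_modEq_mul h).1 ⟨hkl.1, hkl.2⟩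
    exact Nat.ModEq.eq_of_lt_of_lt this hk.1 hl.1

theorem measure_Lset_lt_top {a : ℕ} (ha : 0 < a) (σ : ℝ) :
    volume {x : ℝ | ∃ d : ℕ, d ∣ a ∧ Real.exp x < (d : ℝ) ∧ (d : ℝ) ≤ Real.exp (x + σ)} < ⊤ := by
  refine (measure_mono (t := Set.Icc (-σ) (Real.log a)) ?_).trans_lt measure_Icc_lt_top
  rintro x ⟨d, hd, h1, h2⟩
  have hd0 : 0 < d := Nat.pos_of_dvd_of_pos hd ha
  constructor
  · have : Real.exp 0 ≤ Real.exp (x + σ) := by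
      rw [Real.exp_zero]
      exact le_trans (by exact_mod_cast hd0) h2
    linarith [Real.exp_le_exp.1 this]
  · rw [Real.le_log_iff_exp_le (by exact_mod_cast ha)]
    exact h1.le.trans (by exact_mod_cast Nat.le_of_dvd ha hd)

theorem Lfun_nonneg (a : ℕ) (σ : ℝ) : 0 ≤ Lfun a σ := ENNReal.toReal_nonneg

theorem Lfun_prime_mul_le {p a : ℕ} (hp : p.Prime) (ha : 0 < a) (σ : ℝ) :
    Lfun (p * a) σ ≤ 2 * Lfun a σ := by
  set S := {x : ℝ | ∃ d : ℕ, d ∣ a ∧ Real.exp x < (d : ℝ) ∧ (d : ℝ) ≤ Real.exp (x + σ)} with hS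
  have hfin : volume S ≠ ⊤ := (measure_Lset_lt_top ha σ).ne
  have hp0 : (0 : ℝ) < p := by exact_mod_cast hp.pos
  have hsub : {x : ℝ | ∃ d : ℕ, d ∣ p * a ∧ Real.exp x < (d : ℝ) ∧ (d : ℝ) ≤ Real.exp (x + σ)} ⊆
      S ∪ (fun x => x + -Real.log p) ⁻¹' S := by
    rintro x ⟨d, hd, h1, h2⟩
    obtain ⟨d₁, d₂, hd₁, hd₂, rfl⟩ := Nat.dvd_mul.1 hd
    rcases (Nat.dvd_prime hp).1 hd₁ with rfl | rfl
    · exact Or.inl ⟨d₂, hd₂, by simpa using h1, by simpa using h2⟩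
    · refine Or.inr ⟨d₂, hd₂, ?_, ?_⟩
      · rw [Real.exp_add, Real.exp_neg, Real.exp_log hp0, ← div_eq_mul_inv, div_lt_iff₀ hp0]
        push_cast at h1
        linarith
      · rw [add_right_comm, Real.exp_add, Real.exp_neg, Real.exp_log hp0, ← div_eq_mul_inv,
          le_div_iff₀ hp0]
        push_cast at h2
        linarith
  have h : volume {x : ℝ | ∃ d : ℕ, d ∣ p * a ∧ Real.exp x < (d : ℝ) ∧
      (d : ℝ) ≤ Real.exp (x + σ)} ≤ volume S + volume S := by
    refine (measure_mono hsub).trans ((measure_union_le _ _).trans ?_)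
    rw [measure_preimage_add_right]
  unfold Lfun
  rw [two_mul, ← ENNReal.toReal_add hfin hfin]
  exact ENNReal.toReal_mono (ENNReal.add_ne_top.2 ⟨hfin, hfin⟩) h

theorem sum_log_div_primesIoc_le {x : ℝ} (hx : 2 ≤ x) :
    ∑ p ∈ primesIoc 1 x, Real.log p / p ≤ 3 * Real.log x := by
  set n := ⌊x⌋₊ with hn
  have hn2 : 2 ≤ n := Nat.le_floor (by exact_mod_cast hx)
  have hn0 : (0 : ℝ) < n := by exact_mod_cast (by omega : 0 < n)
  have hnx : (n : ℝ) ≤ x := Nat.floor_le (by linarith)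
  have hprime : ∀ p ∈ primesIoc 1 x, p.Prime := fun p hp => (mem_primesIoc.1 hp).1
  have hdvd : (∏ p ∈ primesIoc 1 x, p ^ (n / p)) ∣ n.factorial := by
    refine Finset.prod_dvd_of_isRelPrime (fun p hp q hq hpq => ?_) fun p hp => ?_
    · exact Nat.coprime_iff_isRelPrime.1 (Nat.Coprime.pow _ _
        ((Nat.coprime_primes (hprime p hp) (hprime q hq)).2 hpq))
    · refine ((hprime p hp).pow_dvd_factorial_iff (b := Nat.log p n + 2) (by omega)).2 ?_
      have := Finset.single_le_sum (f := fun i => n / p ^ i) (fun _ _ => Nat.zero_le _)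
        (Finset.mem_Ico.2 ⟨le_rfl, by omega⟩ : 1 ∈ Finset.Ico 1 (Nat.log p n + 2))
      simpa using this
  have hle : (∏ p ∈ primesIoc 1 x, (p : ℝ) ^ (n / p)) ≤ (n : ℝ) ^ n := by
    exact_mod_cast (Nat.le_of_dvd n.factorial_pos hdvd).trans n.factorial_le_pow
  have hpos : ∀ p ∈ primesIoc 1 x, (0 : ℝ) < p := fun p hp => by
    exact_mod_cast (hprime p hp).pos
  have h1 : ∑ p ∈ primesIoc 1 x, ((n / p : ℕ) : ℝ) * Real.log p ≤ n * Real.log n := by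
    have := Real.log_le_log (Finset.prod_pos fun p hp => pow_pos (hpos p hp) _) hle
    rw [Real.log_pow, Real.log_prod fun p hp => (pow_pos (hpos p hp) _).ne'] at this
    simpa only [Real.log_pow] using this
  have h2 : ∑ p ∈ primesIoc 1 x, Real.log p ≤ Real.log 4 * n := by
    refine le_trans (le_of_eq ?_) (Chebyshev.theta_le_log4_mul_x hn0.le)
    rw [Chebyshev.theta]
    refine Finset.sum_congr ?_ fun _ _ => rfl
    ext p
    simp only [mem_primesIoc, Finset.mem_filter, Finset.mem_Ioc, Nat.floor_natCast]
    constructor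
    · rintro ⟨hp, -, h⟩
      exact ⟨⟨hp.pos, Nat.le_floor h⟩, hp⟩
    · rintro ⟨⟨-, h⟩, hp⟩
      exact ⟨hp, by exact_mod_cast hp.one_lt, (Nat.cast_le.2 h).trans hnx⟩
  have h3 : ∀ p ∈ primesIoc 1 x, (n : ℝ) * (Real.log p / p) ≤
      ((n / p : ℕ) : ℝ) * Real.log p + Real.log p := by
    intro p hp
    have h : (n : ℝ) / p ≤ ((n / p : ℕ) : ℝ) + 1 := by
      rw [← Nat.floor_div_eq_div (K := ℝ)]
      exact (Nat.lt_floor_add_one _).le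
    have hl : 0 ≤ Real.log p := Real.log_natCast_nonneg p
    calc (n : ℝ) * (Real.log p / p) = n / p * Real.log p := by ring
      _ ≤ (((n / p : ℕ) : ℝ) + 1) * Real.log p := mul_le_mul_of_nonneg_right h hl
      _ = _ := by ring
  have h4 : (n : ℝ) * ∑ p ∈ primesIoc 1 x, Real.log p / p ≤ n * (Real.log n + Real.log 4) := by
    rw [Finset.mul_sum]
    refine (Finset.sum_le_sum h3).trans ?_
    rw [Finset.sum_add_distrib]
    linarith
  have h5 := le_of_mul_le_mul_left h4 hn0
  have h6 : Real.log 4 = 2 * Real.log 2 := by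
    rw [show (4 : ℝ) = 2 ^ 2 by norm_num, Real.log_pow]; norm_num
  have h7 : Real.log 2 ≤ Real.log x := Real.log_le_log (by norm_num) hx
  have h8 : Real.log n ≤ Real.log x := Real.log_le_log hn0 hnx
  linarith

theorem sum_inv_primesIoc_le {u v : ℝ} (hu : 2 ≤ u) (huv : u ≤ v) :
    ∑ p ∈ primesIoc u v, (1 : ℝ) / p ≤ 3 * Real.log v / Real.log u := by
  have hlu : 0 < Real.log u := Real.log_pos (by linarith)
  rw [le_div_iff₀ hlu, Finset.sum_mul]
  refine le_trans ?_ (sum_log_div_primesIoc_le (hu.trans huv))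
  rw [← primesIoc_union (by linarith : (1 : ℝ) ≤ u) huv,
    Finset.sum_union (disjoint_primesIoc _ _ _)]
  refine le_add_of_nonneg_of_le
    (Finset.sum_nonneg fun p _ => div_nonneg (Real.log_natCast_nonneg p) p.cast_nonneg)
    (Finset.sum_le_sum fun p hp => ?_)
  have h := (mem_primesIoc.1 hp).2.1
  rw [div_mul_eq_mul_div, one_mul]
  exact div_le_div_of_nonneg_right (Real.log_le_log (by linarith) h.le) p.cast_nonneg

theorem rpow_neg_one_add_inv_log {p : ℕ} (hp : 0 < p) (t : ℝ) :
    (p : ℝ) ^ (-(1 + 1 / Real.log t)) = 1 / p * Real.exp (-(Real.log p / Real.log t)) := by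
  have hp0 : (0 : ℝ) < p := by exact_mod_cast hp
  rw [Real.rpow_def_of_pos hp0, one_div (p : ℝ), ← Real.exp_log (inv_pos.2 hp0), ← Real.exp_add,
    Real.log_inv]
  congr 1
  ring

theorem sum_rpow_primesIoc_pow_le {t : ℝ} (ht : 2 ≤ t) (n : ℕ) :
    ∑ p ∈ primesIoc t (t ^ (n + 1)), (p : ℝ) ^ (-(1 + 1 / Real.log t)) ≤
      6 * (1 - (1 / 2) ^ n) := by
  have hlt : 0 < Real.log t := Real.log_pos (by linarith)
  have hempty : primesIoc t (t ^ (0 + 1)) = ∅ := by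
    ext p
    simp only [mem_primesIoc, zero_add, pow_one, Finset.notMem_empty, iff_false, not_and, not_le]
    exact fun _ h => h
  induction n with
  | zero => rw [hempty]; simp
  | succ n ih =>
    have h1 : t ≤ t ^ (n + 1) := le_self_pow₀ (by linarith) (by omega)
    have h2 : t ^ (n + 1) ≤ t ^ (n + 1 + 1) := pow_le_pow_right₀ (by linarith) (by omega)
    rw [← primesIoc_union h1 h2, Finset.sum_union (disjoint_primesIoc _ _ _)]
    have hexp : Real.exp (-((n : ℝ) + 1)) ≤ (1 / 2) ^ (n + 1) := by
      have h : Real.exp (-1) ≤ 1 / 2 := by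
        rw [Real.exp_neg, one_div]
        exact inv_anti₀ (by norm_num) (by linarith [Real.add_one_le_exp 1])
      calc Real.exp (-((n : ℝ) + 1)) = Real.exp (-1) ^ (n + 1) := by
            rw [← Real.exp_nat_mul]; push_cast; ring_nf
        _ ≤ _ := pow_le_pow_left₀ (Real.exp_pos _).le h _
    have h3 : ∑ p ∈ primesIoc (t ^ (n + 1)) (t ^ (n + 1 + 1)),
        (p : ℝ) ^ (-(1 + 1 / Real.log t)) ≤
        (∑ p ∈ primesIoc (t ^ (n + 1)) (t ^ (n + 1 + 1)), (1 : ℝ) / p) * (1 / 2) ^ (n + 1) := by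
      rw [Finset.sum_mul]
      refine Finset.sum_le_sum fun p hp => ?_
      obtain ⟨hp, hlow, -⟩ := mem_primesIoc.1 hp
      rw [rpow_neg_one_add_inv_log hp.pos]
      refine mul_le_mul_of_nonneg_left (le_trans (Real.exp_le_exp.2 (neg_le_neg ?_)) hexp)
        (by positivity)
      rw [le_div_iff₀ hlt]
      have := Real.log_le_log (by positivity) hlow.le
      rw [Real.log_pow] at this
      exact_mod_cast this
    have h4 : ∑ p ∈ primesIoc (t ^ (n + 1)) (t ^ (n + 1 + 1)), (1 : ℝ) / p ≤ 6 := by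
      refine (sum_inv_primesIoc_le (ht.trans h1) h2).trans ?_
      rw [Real.log_pow, Real.log_pow, div_le_iff₀ (by positivity)]
      push_cast
      have : 0 ≤ (n : ℝ) * Real.log t := by positivity
      nlinarith
    have h5 := mul_le_mul_of_nonneg_right h4 (by positivity : (0 : ℝ) ≤ (1 / 2) ^ (n + 1))
    have h6 : (1 / 2 : ℝ) ^ (n + 1) = (1 / 2) ^ n * (1 / 2) := pow_succ _ _
    linarith

theorem sum_rpow_primesIoc_le {t : ℝ} (ht : 2 ≤ t) (v : ℝ) :
    ∑ p ∈ primesIoc t v, (p : ℝ) ^ (-(1 + 1 / Real.log t)) ≤ 6 := by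
  obtain ⟨n, hn⟩ := pow_unbounded_of_one_lt v (by linarith : 1 < t)
  have hsub : primesIoc t v ⊆ primesIoc t (t ^ (n + 1)) := by
    intro p hp
    rw [mem_primesIoc] at hp ⊢
    exact ⟨hp.1, hp.2.1, hp.2.2.trans (hn.le.trans (pow_le_pow_right₀ (by linarith) (by omega)))⟩
  refine (Finset.sum_le_sum_of_subset_of_nonneg hsub fun _ _ _ => by positivity).trans
    ((sum_rpow_primesIoc_pow_le ht n).trans ?_)
  have : (0 : ℝ) ≤ (1 / 2) ^ n := by positivity
  linarith

theorem sum_div_le_sum_rpow_add {a : ℕ → ℝ} {A : ℝ} (ha : ∀ p, p.Prime → 0 ≤ a p ∧ a p ≤ A)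
    {t : ℝ} (ht : 2 ≤ t) :
    ∑ p ∈ primesIoc 1 t, a p / p ≤
      ∑ p ∈ primesIoc 1 t, a p * (p : ℝ) ^ (-(1 + 1 / Real.log t)) + 3 * A := by
  have hlt : 0 < Real.log t := Real.log_pos (by linarith)
  have hA : 0 ≤ A := (ha 2 Nat.prime_two).1.trans (ha 2 Nat.prime_two).2
  have key : ∀ p ∈ primesIoc 1 t, a p / p ≤
      a p * (p : ℝ) ^ (-(1 + 1 / Real.log t)) + A / Real.log t * (Real.log p / p) := by
    intro p hp
    have hp' := (mem_primesIoc.1 hp).1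
    rw [rpow_neg_one_add_inv_log hp'.pos]
    have h1 := Real.add_one_le_exp (-(Real.log p / Real.log t))
    have hp0 : (0 : ℝ) < p := by exact_mod_cast hp'.pos
    have h2 : 0 ≤ a p / p := div_nonneg (ha p hp').1 hp0.le
    have h3 : a p / p * (Real.log p / Real.log t) ≤ A / p * (Real.log p / Real.log t) :=
      mul_le_mul_of_nonneg_right (div_le_div_of_nonneg_right (ha p hp').2 hp0.le)
        (div_nonneg (Real.log_natCast_nonneg p) hlt.le)
    have h4 := mul_le_mul_of_nonneg_left h1 h2
    have e1 : a p * (1 / p * Real.exp (-(Real.log p / Real.log t))) =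
      a p / p * Real.exp (-(Real.log p / Real.log t)) := by ring
    have e2 : A / Real.log t * (Real.log p / p) = A / p * (Real.log p / Real.log t) := by ring
    rw [e1, e2]
    linarith
  refine (Finset.sum_le_sum key).trans ?_
  rw [Finset.sum_add_distrib, ← Finset.mul_sum]
  have h := mul_le_mul_of_nonneg_left (sum_log_div_primesIoc_le ht)
    (by positivity : 0 ≤ A / Real.log t)
  have e : A / Real.log t * (3 * Real.log t) = 3 * A := by field_simp
  linarith

theorem sum_rpow_le_sum_div_add {a : ℕ → ℝ} {A : ℝ} (ha : ∀ p, p.Prime → 0 ≤ a p ∧ a p ≤ A)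
    {t : ℝ} (ht : 2 ≤ t) (v : ℝ) :
    ∑ p ∈ primesIoc 1 v, a p * (p : ℝ) ^ (-(1 + 1 / Real.log t)) ≤
      ∑ p ∈ primesIoc 1 t, a p / p + 6 * A := by
  have hlt : 0 < Real.log t := Real.log_pos (by linarith)
  have hA : 0 ≤ A := (ha 2 Nat.prime_two).1.trans (ha 2 Nat.prime_two).2
  have hsub : primesIoc 1 v ⊆ primesIoc 1 (max t v) := by
    intro p hp
    rw [mem_primesIoc] at hp ⊢
    exact ⟨hp.1, hp.2.1, hp.2.2.trans (le_max_right _ _)⟩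
  refine (Finset.sum_le_sum_of_subset_of_nonneg hsub fun p hp _ =>
    mul_nonneg (ha p (mem_primesIoc.1 hp).1).1 (by positivity)).trans ?_
  rw [← primesIoc_union (by linarith : (1 : ℝ) ≤ t) (le_max_left t v),
    Finset.sum_union (disjoint_primesIoc _ _ _)]
  refine add_le_add (Finset.sum_le_sum fun p hp => ?_) ?_
  · have hp' := (mem_primesIoc.1 hp).1
    rw [rpow_neg_one_add_inv_log hp'.pos, ← mul_assoc, mul_one_div]
    refine mul_le_of_le_one_right (div_nonneg (ha p hp').1 p.cast_nonneg) (Real.exp_le_one_iff.2 ?_)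
    exact neg_nonpos.2 (div_nonneg (Real.log_natCast_nonneg p) hlt.le)
  · rw [mul_comm (6 : ℝ)]
    refine le_trans (Finset.sum_le_sum fun p hp => ?_)
      ((Finset.mul_sum _ _ A).symm.le.trans
        (mul_le_mul_of_nonneg_left (sum_rpow_primesIoc_le ht (max t v)) hA))
    exact mul_le_mul_of_nonneg_right (ha p (mem_primesIoc.1 hp).1).2 (by positivity)

theorem summable_add_pow_mul_half_pow (d : ℕ) :
    Summable fun e : ℕ => ((e : ℝ) + 3) ^ d * (1 / 2) ^ e := by
  have h := summable_pow_mul_geometric_of_norm_lt_one d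
    (by norm_num : ‖(1 / 2 : ℝ)‖ < 1)
  have h' := ((summable_nat_add_iff 3).2 h).mul_left 8
  refine h'.congr fun e => ?_
  rw [pow_add]
  push_cast
  ring

theorem sum_inv_sq_primesIoc_le (v : ℝ) :
    ∑ p ∈ primesIoc 1 v, 1 / (p : ℝ) ^ 2 ≤ ∑' n : ℕ, 1 / (n : ℝ) ^ 2 :=
  (Real.summable_one_div_nat_pow.2 one_lt_two).sum_le_tsum _ fun _ _ => by positivity

theorem local_factor_bounds {a : ℕ → ℝ} (ha : ∀ n, 0 ≤ a n) (ha1 : a 1 = 1) {d : ℕ} {p : ℕ}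
    (hp : p.Prime) (hpow : ∀ e : ℕ, a (p ^ e) ≤ ((e : ℝ) + 1) ^ d) {σ : ℝ} (hσ : 1 < σ)
    (hsum : Summable fun n : ℕ => a n * (n : ℝ) ^ (-σ)) :
    1 + a p * (p : ℝ) ^ (-σ) ≤ ∑' e : ℕ, a (p ^ e) * ((p ^ e : ℕ) : ℝ) ^ (-σ) ∧
    ∑' e : ℕ, a (p ^ e) * ((p ^ e : ℕ) : ℝ) ^ (-σ) ≤ 1 + a p * (p : ℝ) ^ (-σ) +
      (∑' e : ℕ, ((e : ℝ) + 3) ^ d * (1 / 2) ^ e) * (1 / (p : ℝ) ^ 2) := by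
  have hp2 : (2 : ℝ) ≤ p := by exact_mod_cast hp.two_le
  have hs : Summable fun e : ℕ => a (p ^ e) * ((p ^ e : ℕ) : ℝ) ^ (-σ) :=
    hsum.comp_injective (Nat.pow_right_injective hp.two_le)
  have hsplit := hs.sum_add_tsum_nat_add 2
  rw [← hsplit]
  simp only [Finset.sum_range_succ, Finset.sum_range_zero, zero_add, pow_zero, pow_one, ha1,
    Nat.cast_one, Real.one_rpow, mul_one]
  refine ⟨le_add_of_nonneg_right (tsum_nonneg fun e => mul_nonneg (ha _) (by positivity)), ?_⟩
  refine add_le_add le_rfl ?_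
  rw [← tsum_mul_right]
  refine Summable.tsum_le_tsum (fun e => ?_) ((summable_nat_add_iff 2).2 hs)
    ((summable_add_pow_mul_half_pow d).mul_right _)
  have h1 : a (p ^ (e + 2)) ≤ ((e : ℝ) + 3) ^ d := by
    refine (hpow (e + 2)).trans (le_of_eq ?_)
    push_cast
    ring
  have h2 : ((p ^ (e + 2) : ℕ) : ℝ) ^ (-σ) ≤ (1 / 2) ^ e * (1 / (p : ℝ) ^ 2) := by
    have h : (1 : ℝ) ≤ ((p ^ (e + 2) : ℕ) : ℝ) := by exact_mod_cast Nat.one_le_pow _ _ hp.pos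
    calc ((p ^ (e + 2) : ℕ) : ℝ) ^ (-σ) ≤ ((p ^ (e + 2) : ℕ) : ℝ) ^ (-1 : ℝ) :=
          Real.rpow_le_rpow_of_exponent_le h (by linarith)
      _ = (1 / (p : ℝ)) ^ e * (1 / (p : ℝ) ^ 2) := by
          rw [Real.rpow_neg_one]; push_cast; rw [pow_add, mul_inv, one_div_pow, one_div, one_div]
      _ ≤ _ := by
          gcongr
  rw [mul_assoc]
  exact mul_le_mul h1 h2 (by positivity) (by positivity)

theorem exp_sub_sq_le_one_add {y : ℝ} (hy : 0 ≤ y) : Real.exp (y - y ^ 2) ≤ 1 + y := by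
  rw [← Real.le_log_iff_exp_le (by linarith)]
  refine le_trans ?_ (Real.le_log_one_add_of_nonneg hy)
  rw [le_div_iff₀ (by linarith)]
  nlinarith [pow_nonneg hy 3, pow_nonneg hy 2]

theorem primesBelow_eq_primesIoc (N : ℕ) :
    (N + 1).primesBelow = primesIoc 1 N := by
  ext p
  rw [Nat.mem_primesBelow, mem_primesIoc]
  constructor
  · rintro ⟨h, hp⟩
    exact ⟨hp, by exact_mod_cast hp.one_lt, by exact_mod_cast Nat.lt_succ_iff.1 h⟩
  · rintro ⟨hp, -, h⟩
    exact ⟨Nat.lt_succ_iff.2 (by exact_mod_cast h), hp⟩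

theorem primesIoc_floor (r : ℝ) {v : ℝ} (hv : 0 ≤ v) : primesIoc r (⌊v⌋₊ : ℕ) = primesIoc r v := by
  ext p
  rw [mem_primesIoc, mem_primesIoc, Nat.cast_le, Nat.le_floor_iff hv]

theorem dirichletSum_bounds {a : ℕ → ℝ} (ha : ∀ n, 0 ≤ a n) (ha1 : a 1 = 1)
    (hmul : ∀ m n : ℕ, m.Coprime n → a (m * n) = a m * a n) {d : ℕ}
    (hpow : ∀ p e : ℕ, p.Prime → a (p ^ e) ≤ ((e : ℝ) + 1) ^ d) {σ : ℝ} (hσ : 1 < σ)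
    (hsum : Summable fun n : ℕ => a n * (n : ℝ) ^ (-σ)) {Z B : ℝ}
    (hZ : ∑' n : ℕ, 1 / (n : ℝ) ^ 2 = Z) (hB : ∑' e : ℕ, ((e : ℝ) + 3) ^ d * (1 / 2) ^ e = B) :
    (∀ v : ℝ, 0 ≤ v → Real.exp (∑ p ∈ primesIoc 1 v, a p * (p : ℝ) ^ (-σ) - (2 ^ d) ^ 2 * Z) ≤
      ∑' n : ℕ, a n * (n : ℝ) ^ (-σ)) ∧
    (∀ M : ℝ, (∀ v : ℝ, ∑ p ∈ primesIoc 1 v, a p * (p : ℝ) ^ (-σ) ≤ M) →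
      ∑' n : ℕ, a n * (n : ℝ) ^ (-σ) ≤ Real.exp (M + B * Z)) := by
  set f : ℕ → ℝ := fun n => a n * (n : ℝ) ^ (-σ) with hf
  have hf0 : ∀ n, 0 ≤ f n := fun n => mul_nonneg (ha n) (by positivity)
  have hf1 : f 1 = 1 := by simp [hf, ha1]
  have hfz : f 0 = 0 := by simp [hf, Real.zero_rpow (by linarith : -σ ≠ 0)]
  have hfm : ∀ {m n : ℕ}, m.Coprime n → f (m * n) = f m * f n := by
    intro m n h
    simp only [hf, hmul m n h, Nat.cast_mul, Real.mul_rpow m.cast_nonneg n.cast_nonneg]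
    ring
  have hB0 : 0 ≤ B := hB ▸ tsum_nonneg fun e => by positivity
  have hnorm : Summable fun n => ‖f n‖ := hsum.norm
  have hloc : ∀ p : ℕ, p.Prime → _ := fun p hp =>
    local_factor_bounds ha ha1 hp (fun e => hpow p e hp) hσ hsum
  refine ⟨fun v hv => ?_, fun M hM => ?_⟩
  · rw [← primesIoc_floor 1 hv]
    have hprod := EulerProduct.prod_primesBelow_tsum_eq_tsum_smoothNumbers hf1 hfm hnorm
      (⌊v⌋₊ + 1)
    have hle : ∑' m : (⌊v⌋₊ + 1).smoothNumbers, f m ≤ ∑' n, f n :=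
      hsum.tsum_subtype_le f _ hf0
    refine le_trans ?_ (hprod.le.trans hle)
    rw [primesBelow_eq_primesIoc]
    have h1 : ∑ p ∈ primesIoc 1 (⌊v⌋₊ : ℕ), a p * (p : ℝ) ^ (-σ) - (2 ^ d) ^ 2 * Z ≤
        ∑ p ∈ primesIoc 1 (⌊v⌋₊ : ℕ), (f p - f p ^ 2) := by
      rw [Finset.sum_sub_distrib]
      refine sub_le_sub le_rfl ?_
      refine le_trans ?_ (mul_le_mul_of_nonneg_left ((sum_inv_sq_primesIoc_le (⌊v⌋₊ : ℕ)).trans_eq hZ)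
        (by positivity))
      rw [Finset.mul_sum]
      refine Finset.sum_le_sum fun p hp => ?_
      have hp' := (mem_primesIoc.1 hp).1
      rw [mul_one_div, ← div_pow]
      refine pow_le_pow_left₀ (hf0 p) ?_ 2
      have ha2 : a p ≤ 2 ^ d := by
        have := hpow p 1 hp'
        rw [pow_one] at this
        exact this.trans_eq (by norm_num)
      have hp1 : (1 : ℝ) ≤ p := by exact_mod_cast hp'.one_le
      rw [div_eq_mul_inv, ← Real.rpow_neg_one]
      exact mul_le_mul ha2 (Real.rpow_le_rpow_of_exponent_le hp1 (by linarith)) (by positivity)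
        (by positivity)
    refine (Real.exp_le_exp.2 h1).trans ?_
    rw [Real.exp_sum]
    exact Finset.prod_le_prod (fun p _ => (Real.exp_pos _).le) fun p hp =>
      (exp_sub_sq_le_one_add (hf0 p)).trans (hloc p (mem_primesIoc.1 hp).1).1
  · have hlim := EulerProduct.eulerProduct hf1 hfm hnorm hfz
    refine le_of_tendsto (hlim.comp (Filter.tendsto_add_atTop_nat 1))
      (Filter.Eventually.of_forall fun N => ?_)
    simp only [Function.comp_apply]
    rw [primesBelow_eq_primesIoc]
    have h1 : ∑ p ∈ primesIoc 1 (N : ℝ), (f p + B * (1 / (p : ℝ) ^ 2)) ≤ M + B * Z := by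
      rw [Finset.sum_add_distrib, ← Finset.mul_sum]
      exact add_le_add (hM N) (mul_le_mul_of_nonneg_left
        ((sum_inv_sq_primesIoc_le _).trans_eq hZ) hB0)
    refine le_trans ?_ (Real.exp_le_exp.2 h1)
    rw [Real.exp_sum]
    refine Finset.prod_le_prod (fun p _ => tsum_nonneg fun e => hf0 _) fun p hp => ?_
    refine ((hloc p (mem_primesIoc.1 hp).1).2.trans (le_of_eq ?_)).trans (Real.add_one_le_exp _)
    rw [hB]
    ring

/-- An upper bound of Mertens type for the coefficients at primes of a Dirichlet series whose
behaviour at `1` is that of a simple pole. -/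
theorem exists_sum_div_primesIoc_le {a : ℕ → ℝ} (ha : ∀ n, 0 ≤ a n) (ha1 : a 1 = 1)
    (hmul : ∀ m n : ℕ, m.Coprime n → a (m * n) = a m * a n) {d : ℕ}
    (hpow : ∀ p e : ℕ, p.Prime → a (p ^ e) ≤ ((e : ℝ) + 1) ^ d) {c C : ℝ} (hc : 0 < c)
    (hpole : ∀ σ : ℝ, 1 < σ → σ ≤ 3 → Summable (fun n : ℕ => a n * (n : ℝ) ^ (-σ)) ∧
      c ≤ (σ - 1) * ∑' n : ℕ, a n * (n : ℝ) ^ (-σ) ∧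
      (σ - 1) * ∑' n : ℕ, a n * (n : ℝ) ^ (-σ) ≤ C) :
    ∃ D : ℝ, ∀ s t : ℝ, 2 ≤ s → s ≤ t →
      ∑ p ∈ primesIoc s t, a p / p ≤ Real.log (Real.log t / Real.log s) + D := by
  obtain ⟨Z, hZ⟩ : ∃ Z, ∑' n : ℕ, 1 / (n : ℝ) ^ 2 = Z := ⟨_, rfl⟩
  obtain ⟨B, hB⟩ : ∃ B, ∑' e : ℕ, ((e : ℝ) + 3) ^ d * (1 / 2) ^ e = B := ⟨_, rfl⟩
  have hA : ∀ p : ℕ, p.Prime → 0 ≤ a p ∧ a p ≤ 2 ^ d := fun p hp => by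
    refine ⟨ha p, ?_⟩
    have := hpow p 1 hp
    rw [pow_one] at this
    exact this.trans_eq (by norm_num)
  have hC : 0 < C := by
    obtain ⟨-, h1, h2⟩ := hpole 2 (by norm_num) (by norm_num)
    linarith
  have hσ : ∀ x : ℝ, 2 ≤ x → 0 < Real.log x ∧ 1 < 1 + 1 / Real.log x ∧
      1 + 1 / Real.log x ≤ 3 := by
    intro x hx
    have h2 : 1 / 2 ≤ Real.log x :=
      (by linarith [Real.log_two_gt_d9] : (1 : ℝ) / 2 ≤ Real.log 2).trans
        (Real.log_le_log (by norm_num) hx)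
    have h0 : 0 < Real.log x := by linarith
    refine ⟨h0, lt_add_of_pos_right _ (by positivity), ?_⟩
    have : 1 / Real.log x ≤ 2 := by
      rw [div_le_iff₀ h0]; linarith
    linarith
  have hupper : ∀ t : ℝ, 2 ≤ t → ∑ p ∈ primesIoc 1 t, a p / p ≤
      Real.log (Real.log t) + (Real.log C + (2 ^ d) ^ 2 * Z + 3 * 2 ^ d) := by
    intro t ht
    obtain ⟨h0, h1, h3⟩ := hσ t ht
    obtain ⟨hsum, -, hle⟩ := hpole _ h1 h3
    have hb := (dirichletSum_bounds ha ha1 hmul hpow h1 hsum hZ hB).1 t (by linarith)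
    have hz : ∑' n : ℕ, a n * (n : ℝ) ^ (-(1 + 1 / Real.log t)) ≤ C * Real.log t := by
      rw [add_sub_cancel_left, one_div_mul_eq_div, div_le_iff₀ h0] at hle
      exact hle
    have h5 := (Real.le_log_iff_exp_le (by positivity)).2 (hb.trans hz)
    rw [Real.log_mul hC.ne' h0.ne'] at h5
    linarith [sum_div_le_sum_rpow_add hA ht]
  have hlower : ∀ s : ℝ, 2 ≤ s → Real.log (Real.log s) + Real.log c ≤
      ∑ p ∈ primesIoc 1 s, a p / p + 6 * 2 ^ d + B * Z := by
    intro s hs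
    obtain ⟨h0, h1, h3⟩ := hσ s hs
    obtain ⟨hsum, hle, -⟩ := hpole _ h1 h3
    have hb := (dirichletSum_bounds ha ha1 hmul hpow h1 hsum hZ hB).2 _
      (fun v => sum_rpow_le_sum_div_add hA hs v)
    rw [add_sub_cancel_left, one_div_mul_eq_div, le_div_iff₀ h0] at hle
    have h5 := (Real.log_le_iff_le_exp (by positivity)).2 (hle.trans hb)
    rw [Real.log_mul hc.ne' h0.ne'] at h5
    linarith
  refine ⟨Real.log C + (2 ^ d) ^ 2 * Z + 3 * 2 ^ d + 6 * 2 ^ d + B * Z - Real.log c,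
    fun s t hs hst => ?_⟩
  have hsplit : ∑ p ∈ primesIoc 1 t, a p / p =
      ∑ p ∈ primesIoc 1 s, a p / p + ∑ p ∈ primesIoc s t, a p / p := by
    rw [← primesIoc_union (by linarith : (1 : ℝ) ≤ s) hst,
      Finset.sum_union (disjoint_primesIoc _ _ _)]
  rw [Real.log_div (hσ t (hs.trans hst)).1.ne' (hσ s hs).1.ne']
  linarith [hupper t (hs.trans hst), hlower s hs]

section IdealCount

open NumberField Ideal

variable (K : Type*) [Field K] [NumberField K]

/-- The number of ideals of norm `n` in the ring of integers of `K`. -/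
noncomputable def idealCount (n : ℕ) : ℕ :=
  Nat.card {I : Ideal (𝓞 K) // absNorm I = n}

instance (n : ℕ) : Finite {I : Ideal (𝓞 K) // absNorm I = n} :=
  (Ideal.finite_setOfPred_absNorm_eq n).to_subtype

theorem idealCount_one : idealCount K 1 = 1 := by
  simp [idealCount, Ideal.absNorm_eq_one_iff]

variable {K}

theorem natCast_mem_of_absNorm_eq {I : Ideal (𝓞 K)} {n : ℕ} (h : absNorm I = n) :
    (n : 𝓞 K) ∈ I := h ▸ Ideal.absNorm_mem I

omit [NumberField K] in
theorem sup_span_natCast_eq_top {I : Ideal (𝓞 K)} {m n : ℕ} (h : m.Coprime n)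
    (hI : (n : 𝓞 K) ∈ I) : I ⊔ Ideal.span {(m : 𝓞 K)} = ⊤ := by
  rw [Ideal.eq_top_iff_one]
  have h' : (IsCoprime (m : ℤ) (n : ℤ)) := Nat.isCoprime_iff_coprime.2 h
  obtain ⟨x, y, hxy⟩ := h'
  have h1 : (1 : 𝓞 K) = (y : 𝓞 K) * n + x * m := by
    have := congrArg (Int.cast : ℤ → 𝓞 K) hxy
    push_cast at this
    rw [← this, add_comm]
  rw [h1]
  exact add_mem (Ideal.mem_sup_left (Ideal.mul_mem_left _ _ hI))
    (Ideal.mem_sup_right (Ideal.mul_mem_left _ _ (Ideal.mem_span_singleton_self _)))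

omit [NumberField K] in
theorem mul_sup_span_natCast {I J : Ideal (𝓞 K)} {m n : ℕ} (h : m.Coprime n)
    (hI : (m : 𝓞 K) ∈ I) (hJ : (n : 𝓞 K) ∈ J) : I * J ⊔ Ideal.span {(m : 𝓞 K)} = I := by
  apply le_antisymm
  · exact sup_le Ideal.mul_le_left ((Ideal.span_singleton_le_iff_mem _).2 hI)
  · calc I = I * (J ⊔ Ideal.span {(m : 𝓞 K)}) := by
          rw [sup_span_natCast_eq_top h hJ, Ideal.mul_top]
      _ = I * J ⊔ I * Ideal.span {(m : 𝓞 K)} := Ideal.mul_sup _ _ _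
      _ ≤ _ := sup_le_sup le_rfl Ideal.mul_le_right

omit [NumberField K] in
theorem sup_span_mul_sup_span {L : Ideal (𝓞 K)} {m n : ℕ} (h : m.Coprime n)
    (hL : ((m * n : ℕ) : 𝓞 K) ∈ L) :
    (L ⊔ Ideal.span {(m : 𝓞 K)}) * (L ⊔ Ideal.span {(n : 𝓞 K)}) = L := by
  apply le_antisymm
  · rw [Ideal.sup_mul, Ideal.mul_sup, Ideal.mul_sup, Ideal.span_singleton_mul_span_singleton]
    refine sup_le (sup_le Ideal.mul_le_left Ideal.mul_le_left) (sup_le Ideal.mul_le_right ?_)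
    rw [Ideal.span_singleton_le_iff_mem]
    exact_mod_cast hL
  · calc L = L * (Ideal.span {(n : 𝓞 K)} ⊔ Ideal.span {(m : 𝓞 K)}) := by
          rw [sup_span_natCast_eq_top h (Ideal.mem_span_singleton_self _), Ideal.mul_top]
      _ = L * Ideal.span {(n : 𝓞 K)} ⊔ Ideal.span {(m : 𝓞 K)} * L := by
          rw [Ideal.mul_sup, mul_comm (Ideal.span {(m : 𝓞 K)})]
      _ ≤ _ := sup_le (Ideal.mul_mono le_sup_left le_sup_right)
          (Ideal.mul_mono le_sup_right le_sup_left)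

theorem absNorm_sup_span_natCast {L : Ideal (𝓞 K)} {m n : ℕ} (h : m.Coprime n) (hm : 0 < m)
    (hn : 0 < n) (hL : absNorm L = m * n) :
    absNorm (L ⊔ Ideal.span {(m : 𝓞 K)}) = m ∧ absNorm (L ⊔ Ideal.span {(n : 𝓞 K)}) = n := by
  have hprod := congrArg absNorm (sup_span_mul_sup_span h (natCast_mem_of_absNorm_eq hL))
  rw [_root_.map_mul, hL] at hprod
  have hdvd : ∀ k : ℕ, absNorm (L ⊔ Ideal.span {(k : 𝓞 K)}) ∣ k ^ Module.finrank ℤ (𝓞 K) :=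
    fun k => Ideal.absNorm_span_natCast (S := 𝓞 K) k ▸ Ideal.absNorm_dvd_absNorm_of_le le_sup_right
  have h1 : absNorm (L ⊔ Ideal.span {(m : 𝓞 K)}) ∣ m :=
    ((h.pow_left _).coprime_dvd_left (hdvd m)).dvd_of_dvd_mul_right (Dvd.intro _ hprod)
  have h2 : absNorm (L ⊔ Ideal.span {(n : 𝓞 K)}) ∣ n :=
    ((h.symm.pow_left _).coprime_dvd_left (hdvd n)).dvd_of_dvd_mul_left (Dvd.intro_left _ hprod)
  have h3 := Nat.le_of_dvd hm h1
  have h4 := Nat.le_of_dvd hn h2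
  constructor <;> nlinarith

theorem idealCount_mul {m n : ℕ} (h : m.Coprime n) :
    idealCount K (m * n) = idealCount K m * idealCount K n := by
  rcases Nat.eq_zero_or_pos m with rfl | hm
  · simp [(Nat.coprime_zero_left n).1 h, idealCount_one]
  rcases Nat.eq_zero_or_pos n with rfl | hn
  · simp [(Nat.coprime_zero_right m).1 h, idealCount_one]
  rw [idealCount, idealCount, idealCount, ← Nat.card_prod]
  refine Nat.card_congr ⟨fun L => ⟨⟨_, (absNorm_sup_span_natCast h hm hn L.2).1⟩,
      ⟨_, (absNorm_sup_span_natCast h hm hn L.2).2⟩⟩,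
    fun P => ⟨P.1.1 * P.2.1, by rw [_root_.map_mul, P.1.2, P.2.2]⟩, fun L => ?_, fun P => ?_⟩
  · exact Subtype.ext (sup_span_mul_sup_span h (natCast_mem_of_absNorm_eq L.2))
  · have h1 := natCast_mem_of_absNorm_eq P.1.2
    have h2 := natCast_mem_of_absNorm_eq P.2.2
    refine Prod.ext (Subtype.ext (mul_sup_span_natCast h h1 h2)) (Subtype.ext ?_)
    simp only
    rw [mul_comm P.1.1]
    exact mul_sup_span_natCast h.symm h2 h1

open UniqueFactorizationMonoid in
theorem idealCount_prime_pow_le {p : ℕ} (hp : p.Prime) (e : ℕ) :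
    idealCount K (p ^ e) ≤ (e + 1) ^ Module.finrank ℤ (𝓞 K) := by
  have hp0 : Ideal.span {(p : 𝓞 K)} ≠ 0 := by simp [hp.ne_zero]
  set S := (normalizedFactors (Ideal.span {(p : 𝓞 K)})).toFinset with hS
  have hdvd : ∀ (I P : Ideal (𝓞 K)) (k : ℕ), absNorm I = p ^ k → P ∈ normalizedFactors I →
      p ∣ absNorm P := by
    intro I P k hI hP
    have hPp := prime_of_normalized_factor P hP
    have h1 : absNorm P ∣ p ^ k := hI ▸ map_dvd absNorm (dvd_of_mem_normalizedFactors hP)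
    obtain ⟨l, -, hl⟩ := (Nat.dvd_prime_pow hp).1 h1
    rw [hl]
    refine dvd_pow_self _ ?_
    rintro rfl
    rw [pow_zero, Ideal.absNorm_eq_one_iff] at hl
    exact hPp.not_isUnit (Ideal.isUnit_iff.2 hl)
  have hS_card : S.card ≤ Module.finrank ℤ (𝓞 K) := by
    have hspan := Ideal.absNorm_span_natCast (S := 𝓞 K) p
    have h1 : ∏ P ∈ S, P ∣ Ideal.span {(p : 𝓞 K)} := by
      rw [Finset.prod_eq_multiset_prod, Multiset.map_id', hS, Multiset.toFinset_val]
      exact (Multiset.prod_dvd_prod_of_le (Multiset.dedup_le _)).trans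
        (prod_normalizedFactors hp0).dvd
    have h2 : p ^ S.card ∣ p ^ Module.finrank ℤ (𝓞 K) := by
      rw [← hspan, ← Finset.prod_const]
      refine dvd_trans ?_ (map_dvd absNorm h1)
      rw [map_prod]
      exact Finset.prod_dvd_prod_of_dvd _ _ fun P hP =>
        hdvd _ P _ hspan (Multiset.mem_toFinset.1 hP)
    exact (Nat.pow_dvd_pow_iff_le_right hp.one_lt).1 h2
  have hne : ∀ I : Ideal (𝓞 K), absNorm I = p ^ e → I ≠ 0 := by
    rintro I hI rfl
    rw [Ideal.zero_eq_bot, Ideal.absNorm_bot] at hI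
    exact (pow_pos hp.pos e).ne hI
  have hmem : ∀ I : Ideal (𝓞 K), absNorm I = p ^ e → ∀ P ∈ normalizedFactors I, P ∈ S := by
    intro I hI P hP
    have hPp := prime_of_normalized_factor P hP
    have hPprime := Ideal.isPrime_of_prime hPp
    have hpP : (p : 𝓞 K) ∈ P := by
      have h1 : ((p ^ e : ℕ) : 𝓞 K) ∈ P :=
        Ideal.le_of_dvd (dvd_of_mem_normalizedFactors hP) (natCast_mem_of_absNorm_eq hI)
      rw [Nat.cast_pow] at h1
      exact hPprime.mem_of_pow_mem _ h1
    rw [hS, Multiset.mem_toFinset, Ideal.mem_normalizedFactors_iff hp0]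
    exact ⟨hPprime, (Ideal.span_singleton_le_iff_mem _).2 hpP⟩
  have hcount : ∀ I : Ideal (𝓞 K), absNorm I = p ^ e → ∀ P,
      (normalizedFactors I).count P < e + 1 := by
    intro I hI P
    by_cases hP : P ∈ normalizedFactors I
    · rw [Nat.lt_succ_iff]
      have h2 := hdvd I P e hI hP
      have h3 : P ^ (normalizedFactors I).count P ∣ I := by
        rw [← Multiset.prod_replicate]
        refine (Multiset.prod_dvd_prod_of_le (Multiset.le_count_iff_replicate_le.1 le_rfl)).trans ?_
        exact (prod_normalizedFactors (hne I hI)).dvd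
      have h4 : p ^ (normalizedFactors I).count P ∣ p ^ e := by
        refine (pow_dvd_pow_of_dvd h2 _).trans ?_
        rw [← map_pow, ← hI]
        exact map_dvd absNorm h3
      exact (Nat.pow_dvd_pow_iff_le_right hp.one_lt).1 h4
    · rw [Multiset.count_eq_zero_of_notMem hP]
      exact Nat.succ_pos e
  let φ : {I : Ideal (𝓞 K) // absNorm I = p ^ e} → (S → Fin (e + 1)) :=
    fun I P => ⟨(normalizedFactors I.1).count P.1, hcount I.1 I.2 P.1⟩
  have hφ : Function.Injective φ := by
    intro I J h
    refine Subtype.ext (associated_iff_eq.1 ((associated_iff_normalizedFactors_eq_normalizedFactors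
      (hne _ I.2) (hne _ J.2)).2 (Multiset.ext.2 fun P => ?_)))
    by_cases hP : P ∈ S
    · exact congrArg Fin.val (congrFun h ⟨P, hP⟩)
    · rw [Multiset.count_eq_zero_of_notMem fun hI => hP (hmem _ I.2 _ hI),
        Multiset.count_eq_zero_of_notMem fun hJ => hP (hmem _ J.2 _ hJ)]
  calc idealCount K (p ^ e) ≤ Nat.card (S → Fin (e + 1)) := Nat.card_le_card_of_injective φ hφ
    _ = (e + 1) ^ S.card := by simp
    _ ≤ _ := Nat.pow_le_pow_right (Nat.succ_pos e) hS_card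

end IdealCount

/-- A Dirichlet series with nonnegative coefficients and a simple pole at `1` is comparable to
`1 / (σ - 1)` for `σ ∈ (1, 3]`. -/
theorem exists_bounds_of_tendsto_sub_one_mul_LSeries {a : ℕ → ℝ} (ha : ∀ n, 0 ≤ a n)
    (ha1 : a 1 = 1) {R : ℝ} (hR : 0 < R)
    (h : Filter.Tendsto (fun s : ℝ => ((s : ℂ) - 1) * LSeries (fun n => (a n : ℂ)) s)
      (nhdsWithin 1 (Set.Ioi 1)) (nhds (R : ℂ))) :
    ∃ c C : ℝ, 0 < c ∧ ∀ σ : ℝ, 1 < σ → σ ≤ 3 → Summable (fun n : ℕ => a n * (n : ℝ) ^ (-σ)) ∧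
      c ≤ (σ - 1) * ∑' n : ℕ, a n * (n : ℝ) ^ (-σ) ∧
      (σ - 1) * ∑' n : ℕ, a n * (n : ℝ) ^ (-σ) ≤ C := by
  have hL : ∀ s : ℝ, 1 < s → ((s : ℂ) - 1) * LSeries (fun n => (a n : ℂ)) s =
      (((s - 1) * ∑' n : ℕ, a n * (n : ℝ) ^ (-s) : ℝ) : ℂ) := by
    intro s hs
    rw [LSeries, Complex.ofReal_mul, Complex.ofReal_sub, Complex.ofReal_one, Complex.ofReal_tsum]
    congr 2
    ext n
    rcases Nat.eq_zero_or_pos n with rfl | hn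
    · simp [Real.zero_rpow (by linarith : -s ≠ 0)]
    · rw [LSeries.term_of_ne_zero hn.ne', Complex.ofReal_mul, Complex.ofReal_cpow n.cast_nonneg,
        Complex.ofReal_natCast, Complex.ofReal_neg, Complex.cpow_neg, div_eq_mul_inv]
  have h' : Filter.Tendsto (fun s : ℝ => (s - 1) * ∑' n : ℕ, a n * (n : ℝ) ^ (-s))
      (nhdsWithin 1 (Set.Ioi 1)) (nhds R) := by
    have h2 := (Complex.continuous_re.tendsto _).comp h
    rw [Complex.ofReal_re] at h2
    refine h2.congr' ?_
    filter_upwards [self_mem_nhdsWithin] with s hs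
    rw [Function.comp_apply, hL s hs, Complex.ofReal_re]
  have hev := h'.eventually (Ioo_mem_nhds (by linarith : R / 2 < R) (by linarith : R < 2 * R))
  obtain ⟨u, hu, hsub⟩ := (mem_nhdsGT_iff_exists_Ioc_subset).1 hev
  have hu : 1 < u := hu
  have hsub : ∀ σ : ℝ, 1 < σ → σ ≤ u → R / 2 < (σ - 1) * ∑' n : ℕ, a n * (n : ℝ) ^ (-σ) ∧
      (σ - 1) * ∑' n : ℕ, a n * (n : ℝ) ^ (-σ) < 2 * R := fun σ h1 h2 => hsub ⟨h1, h2⟩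
  have hsum : ∀ σ : ℝ, 1 < σ → σ ≤ u → Summable (fun n : ℕ => a n * (n : ℝ) ^ (-σ)) := by
    intro σ h1 h2
    by_contra hns
    have := (hsub σ h1 h2).1
    rw [tsum_eq_zero_of_not_summable hns] at this
    linarith
  refine ⟨min (R / 2) (u - 1), max (2 * R) (2 * ∑' n : ℕ, a n * (n : ℝ) ^ (-u)),
    lt_min (by linarith) (by linarith), fun σ h1 h3 => ?_⟩
  rcases le_total σ u with h2 | h2
  · exact ⟨hsum σ h1 h2, (min_le_left _ _).trans (hsub σ h1 h2).1.le,
      (hsub σ h1 h2).2.le.trans (le_max_left _ _)⟩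
  · have hterm : ∀ n : ℕ, a n * (n : ℝ) ^ (-σ) ≤ a n * (n : ℝ) ^ (-u) := by
      intro n
      rcases Nat.eq_zero_or_pos n with rfl | hn
      · simp [Real.zero_rpow (by linarith : -σ ≠ 0), Real.zero_rpow (by linarith : -u ≠ 0)]
      · exact mul_le_mul_of_nonneg_left (Real.rpow_le_rpow_of_exponent_le
          (by exact_mod_cast hn) (by linarith)) (ha n)
    have hσ0 : ∀ n : ℕ, 0 ≤ a n * (n : ℝ) ^ (-σ) := fun n => mul_nonneg (ha n) (by positivity)
    have hs : Summable fun n : ℕ => a n * (n : ℝ) ^ (-σ) :=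
      Summable.of_nonneg_of_le hσ0 hterm (hsum u hu le_rfl)
    have hle := hs.tsum_le_tsum hterm (hsum u hu le_rfl)
    have hge : 1 ≤ ∑' n : ℕ, a n * (n : ℝ) ^ (-σ) := by
      have := hs.le_tsum 1 fun n _ => hσ0 n
      simpa [ha1] using this
    refine ⟨hs, (min_le_right _ _).trans ?_, le_trans ?_ (le_max_right _ _)⟩
    · nlinarith
    · nlinarith

theorem exists_sum_idealCount_div_le (K : Type*) [Field K] [NumberField K] :
    ∃ D : ℝ, ∀ s t : ℝ, 2 ≤ s → s ≤ t →
      ∑ p ∈ primesIoc s t, (idealCount K p : ℝ) / p ≤ Real.log (Real.log t / Real.log s) + D := by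
  have h1 : (idealCount K 1 : ℝ) = 1 := by rw [idealCount_one, Nat.cast_one]
  obtain ⟨c, C, hc, hpole⟩ := exists_bounds_of_tendsto_sub_one_mul_LSeries
    (a := fun n => (idealCount K n : ℝ)) (fun n => Nat.cast_nonneg _) h1
    (NumberField.dedekindZeta_residue_pos K)
    (by
      simp only [Complex.ofReal_natCast]
      exact NumberField.tendsto_sub_one_mul_dedekindZeta_nhdsGT K)
  exact exists_sum_div_primesIoc_le (a := fun n => (idealCount K n : ℝ))
    (fun n => Nat.cast_nonneg _) h1 (fun m n h => by simp only [idealCount_mul h, Nat.cast_mul])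
    (fun p e hp => by exact_mod_cast idealCount_prime_pow_le hp e) hc hpole

section RootCount

open NumberField Ideal Polynomial

variable {K : Type*} [Field K] [NumberField K]

theorem absNorm_ker_ringHom_zmod {p : ℕ} [Fact p.Prime] (φ : 𝓞 K →+* ZMod p) :
    absNorm (RingHom.ker φ) = p := by
  rw [Ideal.absNorm_apply, Submodule.cardQuot_apply]
  exact (Nat.card_congr (RingHom.quotientKerEquivOfSurjective
    (ZMod.ringHom_surjective φ)).toEquiv).trans (Nat.card_zmod p)

theorem exists_ringHom_zmod_apply_eq {p : ℕ} [Fact p.Prime] {θ : 𝓞 K}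
    (hp : ¬ p ∣ RingOfIntegers.exponent θ) {y : ZMod p}
    (hy : ((minpoly ℤ θ).map (Int.castRingHom (ZMod p))).eval y = 0) :
    ∃ φ : 𝓞 K →+* ZMod p, φ θ = y := by
  let ψ : (ZMod p)[X] ⧸ Ideal.span {(minpoly ℤ θ).map (Int.castRingHom (ZMod p))} →+* ZMod p :=
    Ideal.Quotient.lift _ (evalRingHom y) fun a ha => by
      obtain ⟨b, rfl⟩ := Ideal.mem_span_singleton.1 ha
      rw [coe_evalRingHom, eval_mul, hy, zero_mul]
  have hX := RingOfIntegers.ZModXQuotSpanEquivQuotSpan_mk_apply hp X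
  rw [aeval_X, Polynomial.map_X, ← RingEquiv.eq_symm_apply] at hX
  refine ⟨(ψ.comp (RingOfIntegers.ZModXQuotSpanEquivQuotSpan hp).symm.toRingHom).comp
    (Ideal.Quotient.mk _), ?_⟩
  change ψ ((RingOfIntegers.ZModXQuotSpanEquivQuotSpan hp).symm (Ideal.Quotient.mk _ θ)) = y
  rw [← hX]
  change (evalRingHom y) X = y
  rw [coe_evalRingHom, eval_X]

theorem polyRho_le_idealCount {p : ℕ} (hp : p.Prime) {θ : 𝓞 K}
    (hpθ : ¬ p ∣ RingOfIntegers.exponent θ) {F : ℤ[X]} {l : ℤ} (hl : ¬ (p : ℤ) ∣ l)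
    (hF : F ∣ (minpoly ℤ θ).comp (C l * X)) : polyRho F p ≤ idealCount K p := by
  have : Fact p.Prime := ⟨hp⟩
  rw [polyRho_eq_card_filter]
  set A := (Finset.range p).filter fun n : ℕ => (p : ℤ) ∣ F.eval (n : ℤ) with hA
  have hroot : ∀ n : ℕ, (p : ℤ) ∣ F.eval (n : ℤ) →
      ∃ φ : 𝓞 K →+* ZMod p, φ θ = (l : ZMod p) * n := by
    intro n hn
    refine exists_ringHom_zmod_apply_eq hpθ ?_
    have h1 : (p : ℤ) ∣ (minpoly ℤ θ).eval (l * n) := by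
      have h2 : F.eval (n : ℤ) ∣ ((minpoly ℤ θ).comp (C l * X)).eval (n : ℤ) := eval_dvd hF
      rw [eval_comp, eval_mul, eval_C, eval_X] at h2
      exact hn.trans h2
    rw [← ZMod.intCast_zmod_eq_zero_iff_dvd _ p] at h1
    rw [← h1]
    have h3 := eval_intCast_map (Int.castRingHom (ZMod p)) (minpoly ℤ θ) (l * n)
    simpa using h3
  choose φ hφ using hroot
  have hA' : ∀ n : A, (p : ℤ) ∣ F.eval ((n : ℕ) : ℤ) := fun n => (Finset.mem_filter.1 n.2).2
  have hinj : Function.Injective fun n : A =>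
      (⟨RingHom.ker (φ n.1 (hA' n)), absNorm_ker_ringHom_zmod _⟩ : {I : Ideal (𝓞 K) // absNorm I = p}) := by
    intro n m hnm
    have hn := (Finset.mem_filter.1 n.2).1
    have hm := (Finset.mem_filter.1 m.2).1
    have hker : RingHom.ker (φ n.1 (hA' n)) = RingHom.ker (φ m.1 (hA' m)) := congrArg Subtype.val hnm
    have h1 : θ - (l : 𝓞 K) * (n.1 : ℕ) ∈ RingHom.ker (φ n.1 (hA' n)) := by
      rw [RingHom.mem_ker, map_sub, hφ]
      simp
    rw [hker, RingHom.mem_ker, map_sub, hφ, _root_.map_mul, map_intCast, map_natCast,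
      ← mul_sub, mul_eq_zero, ZMod.intCast_zmod_eq_zero_iff_dvd, or_iff_right hl, sub_eq_zero,
      ZMod.natCast_eq_natCast_iff'] at h1
    rw [Nat.mod_eq_of_lt (Finset.mem_range.1 hn), Nat.mod_eq_of_lt (Finset.mem_range.1 hm)] at h1
    exact Subtype.ext h1.symm
  calc A.card = Nat.card A := by simp
    _ ≤ _ := Nat.card_le_card_of_injective _ hinj

theorem exponent_ne_zero {θ : 𝓞 K} (hθ : Algebra.adjoin ℚ {(θ : K)} = ⊤) :
    RingOfIntegers.exponent θ ≠ 0 := by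
  have hint : IsIntegral ℚ (θ : K) := Algebra.IsIntegral.isIntegral _
  let B := PowerBasis.ofAdjoinEqTop hint hθ
  have hgen : B.gen = (θ : K) := PowerBasis.ofAdjoinEqTop_gen hint hθ
  have hintZ : IsIntegral ℤ (θ : K) := θ.isIntegral_coe
  have hintB : IsIntegral ℤ B.gen := hgen ▸ hintZ
  obtain ⟨D, hD⟩ : ∃ D : ℤ, (D : ℚ) = Algebra.discr ℚ B.basis := by
    refine IsIntegrallyClosed.isIntegral_iff.1 (Algebra.discr_isIntegral (K := ℚ) fun i => ?_)
    rw [B.basis_eq_pow]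
    exact hintB.pow _
  have hD0 : D ≠ 0 := by
    rintro rfl
    exact Algebra.discr_not_zero_of_basis ℚ B.basis (by rw [← hD, Int.cast_zero])
  have hmem : (D : 𝓞 K) ∈ conductor ℤ θ := by
    rw [mem_conductor_iff]
    intro b
    have h1 := Algebra.discr_mul_isIntegral_mem_adjoin (K := ℚ) (L := K) hintB b.isIntegral_coe
    rw [hgen, ← hD, Algebra.adjoin_singleton_eq_range_aeval] at h1
    obtain ⟨P, hP⟩ := h1
    rw [Algebra.adjoin_singleton_eq_range_aeval]
    refine ⟨P, RingOfIntegers.coe_injective ?_⟩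
    change algebraMap (𝓞 K) K (aeval θ P) = algebraMap (𝓞 K) K (D * b)
    rw [← aeval_algebraMap_apply, _root_.map_mul, map_intCast, ← zsmul_eq_mul,
      ← Int.cast_smul_eq_zsmul ℚ]
    exact hP
  have habs : (D.natAbs : 𝓞 K) ∈ conductor ℤ θ := by
    rcases Int.natAbs_eq D with h | h
    · rw [h] at hmem
      simpa using hmem
    · rw [h] at hmem
      simpa using hmem
  rw [RingOfIntegers.exponent_eq_sInf]
  exact (Nat.sInf_mem (⟨_, Int.natAbs_pos.2 hD0, habs⟩ :
    {d : ℕ | 0 < d ∧ (d : 𝓞 K) ∈ conductor ℤ θ}.Nonempty)).1.ne'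

end RootCount

open NumberField Polynomial in
theorem exists_polyRho_le_idealCount {F : ℤ[X]} (hF : Irreducible F) (hdeg : F.natDegree ≠ 0) :
    ∃ (K : Type) (_ : Field K) (_ : NumberField K) (N : ℕ), N ≠ 0 ∧
      ∀ p : ℕ, p.Prime → ¬ p ∣ N → polyRho F p ≤ idealCount K p := by
  have hprim : F.IsPrimitive := hF.isPrimitive hdeg
  have hirr : Irreducible (F.map (Int.castRingHom ℚ)) :=
    (Polynomial.IsPrimitive.Int.irreducible_iff_irreducible_map_cast hprim).1 hF
  have : Fact (Irreducible (F.map (Int.castRingHom ℚ))) := ⟨hirr⟩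
  let K := AdjoinRoot (F.map (Int.castRingHom ℚ))
  let ξ : K := AdjoinRoot.root _
  have hmk : ∀ P : ℚ[X], aeval ξ P = AdjoinRoot.mk (F.map (Int.castRingHom ℚ)) P := by
    intro P
    rw [aeval_def, Subsingleton.elim (algebraMap ℚ K) (AdjoinRoot.of _)]
    exact AdjoinRoot.aeval_eq P
  have hmkZ : ∀ P : ℤ[X], aeval ξ P =
      AdjoinRoot.mk (F.map (Int.castRingHom ℚ)) (P.map (Int.castRingHom ℚ)) := by
    intro P
    rw [← hmk]
    exact (aeval_map_algebraMap ℚ ξ P).symm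
  have hξ : aeval ξ F = 0 := by rw [hmkZ, AdjoinRoot.mk_self]
  have hl : F.leadingCoeff ≠ 0 := leadingCoeff_ne_zero.2 hF.ne_zero
  have hint : IsIntegral ℤ ((F.leadingCoeff : K) * ξ) := by
    refine ⟨integralNormalization F, monic_integralNormalization hF.ne_zero, ?_⟩
    exact integralNormalization_aeval_eq_zero hξ fun x hx => by simpa using hx
  let θ : 𝓞 K := ⟨_, hint⟩
  have hθ : (θ : K) = (F.leadingCoeff : K) * ξ := rfl
  have hadj : Algebra.adjoin ℚ {(θ : K)} = ⊤ := by
    have h1 : ξ = ((F.leadingCoeff : ℚ)⁻¹) • (θ : K) := by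
      rw [hθ, Algebra.smul_def, ← mul_assoc, map_inv₀, map_intCast,
        inv_mul_cancel₀ (Int.cast_ne_zero.2 hl), one_mul]
    have h2 : ξ ∈ Algebra.adjoin ℚ {(θ : K)} := by
      rw [h1]
      exact Subalgebra.smul_mem _ (Algebra.self_mem_adjoin_singleton _ _) _
    refine Algebra.eq_top_iff.2 fun x => ?_
    obtain ⟨P, rfl⟩ := AdjoinRoot.mk_surjective x
    rw [← hmk]
    exact Algebra.adjoin_le (Set.singleton_subset_iff.2 h2) (aeval_mem_adjoin_singleton ℚ ξ)
  have hdvd : F ∣ (minpoly ℤ θ).comp (C F.leadingCoeff * X) := by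
    rw [Polynomial.IsPrimitive.Int.dvd_iff_map_cast_dvd_map_cast _ _ hprim, ← AdjoinRoot.mk_eq_zero,
      ← hmkZ, aeval_comp, _root_.map_mul, aeval_C, aeval_X, eq_intCast, ← hθ]
    change aeval (algebraMap (𝓞 K) K θ) (minpoly ℤ θ) = 0
    rw [aeval_algebraMap_apply, minpoly.aeval, map_zero]
  refine ⟨K, inferInstance, inferInstance, RingOfIntegers.exponent θ * F.leadingCoeff.natAbs,
    mul_ne_zero (exponent_ne_zero hadj) (Int.natAbs_ne_zero.2 hl), fun p hp hpN => ?_⟩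
  refine polyRho_le_idealCount hp (fun h => hpN (h.mul_right _)) (l := F.leadingCoeff)
    (fun h => hpN ((Int.natCast_dvd.1 h).mul_left _)) hdvd

/-- An upper bound of Mertens type for the number of roots modulo primes of an irreducible
polynomial. -/
theorem exists_sum_polyRho_div_le {F : Polynomial ℤ} (hF : Irreducible F)
    (hdeg : F.natDegree ≠ 0) :
    ∃ D : ℝ, ∀ s t : ℝ, 2 ≤ s → s ≤ t →
      ∑ p ∈ primesIoc s t, (polyRho F p : ℝ) / p ≤ Real.log (Real.log t / Real.log s) + D := by
  obtain ⟨K, _, _, N, hN, hle⟩ := exists_polyRho_le_idealCount hF hdeg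
  obtain ⟨D, hD⟩ := exists_sum_idealCount_div_le K
  refine ⟨D + N.primeFactors.card, fun s t hs hst => ?_⟩
  have hterm : ∀ p ∈ primesIoc s t, (polyRho F p : ℝ) / p ≤
      (idealCount K p : ℝ) / p + if p ∈ N.primeFactors then 1 else 0 := by
    intro p hp
    have hp' := (mem_primesIoc.1 hp).1
    have hpos : (0 : ℝ) < p := by exact_mod_cast hp'.pos
    split_ifs with h
    · have h1 : (polyRho F p : ℝ) / p ≤ 1 := by
        rw [div_le_one hpos, Nat.cast_le, polyRho_eq_card_filter]
        exact (Finset.card_filter_le _ _).trans_eq (Finset.card_range p)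
      have h2 : 0 ≤ (idealCount K p : ℝ) / p := by positivity
      linarith
    · rw [add_zero]
      gcongr
      exact hle p hp' fun hpN => h (Nat.mem_primeFactors.2 ⟨hp', hpN, hN⟩)
  have hcard : ∑ p ∈ primesIoc s t, (if p ∈ N.primeFactors then (1 : ℝ) else 0) ≤
      N.primeFactors.card := by
    rw [Finset.sum_ite_mem, Finset.sum_const, nsmul_eq_mul, mul_one, Nat.cast_le]
    exact Finset.card_le_card Finset.inter_subset_right
  have := Finset.sum_le_sum hterm
  rw [Finset.sum_add_distrib] at this
  linarith [hD s t hs hst]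

theorem stmt5 (F : Polynomial ℤ) (hF : Irreducible F) (hdeg : 2 ≤ F.natDegree) :
    ∃ K : ℝ, 0 < K ∧
      ∀ r s t η : ℝ, 2 ≤ r → r < s → s < t → 0 < η →
        ∑' a : (Psf r t), Lfun a η * (polyRho F a : ℝ) / (a : ℝ) ≤
          K * (Real.log t / Real.log s) ^ 2 *
            ∑' a : (Psf r s), Lfun a η * (polyRho F a : ℝ) / (a : ℝ) := by
  obtain ⟨D, hD⟩ := exists_sum_polyRho_div_le hF (by omega)
  refine ⟨Real.exp (2 * D), Real.exp_pos _, fun r s t η hr hrs hst _ => ?_⟩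
  have hlog : ∀ x : ℝ, 2 ≤ x → 0 < Real.log x := fun x hx => Real.log_pos (by linarith)
  have hs : 2 ≤ s := by linarith
  let f : ℕ → ℝ := fun a => Lfun a η * (polyRho F a : ℝ) / (a : ℝ)
  let g : ℕ → ℝ := fun p => 2 * ((polyRho F p : ℝ) / p)
  have hf : ∀ a, 0 ≤ f a := fun a =>
    div_nonneg (mul_nonneg (Lfun_nonneg _ _) (Nat.cast_nonneg _)) (Nat.cast_nonneg _)
  have hg : ∀ p, 0 ≤ g p := fun p => by positivity
  have hfg : ∀ p m : ℕ, p.Prime → 0 < m → Nat.Coprime p m → f (p * m) ≤ g p * f m := by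
    intro p m hp hm hpm
    have h1 := Lfun_prime_mul_le hp hm η
    have h2 : (polyRho F (p * m) : ℝ) ≤ polyRho F p * polyRho F m := by
      exact_mod_cast polyRho_mul_le F hp.pos hm hpm
    have h3 : g p * f m =
        2 * Lfun m η * ((polyRho F p : ℝ) * polyRho F m) / ((p * m : ℕ) : ℝ) := by
      simp only [f, g]
      push_cast
      simp only [div_eq_mul_inv, mul_inv]
      ring
    rw [h3]
    simp only [f]
    gcongr
    exact mul_nonneg zero_le_two (Lfun_nonneg _ _)
  have hmain := subsetProdSum_union_le_exp hf hg hfg (primesIoc r s) (primesIoc s t)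
    (fun p hp => (mem_primesIoc.1 hp).1) (fun p hp => (mem_primesIoc.1 hp).1)
    (disjoint_primesIoc r s t)
  rw [primesIoc_union hrs.le hst.le, ← Finset.mul_sum] at hmain
  rw [tsum_Psf r t f, tsum_Psf r s f]
  refine hmain.trans (mul_le_mul_of_nonneg_right ?_ (subsetProdSum_nonneg _ hf))
  have hx : 0 < Real.log t / Real.log s := div_pos (hlog t (by linarith)) (hlog s hs)
  calc Real.exp (2 * ∑ p ∈ primesIoc s t, (polyRho F p : ℝ) / p)
      ≤ Real.exp (2 * D + 2 * Real.log (Real.log t / Real.log s)) := by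
        rw [Real.exp_le_exp]
        linarith [hD s t hs hst.le]
    _ = Real.exp (2 * D) * (Real.log t / Real.log s) ^ 2 := by
        rw [Real.exp_add, two_mul (Real.log _), Real.exp_add, Real.exp_log hx, sq]
end

section
/- Let F ∈ ℤ[t] be an irreducible polynomial of degree g ≥ 2. There exist constants D ≥ 2 and c₅ > 0, depending only on F, such that ρ(p)/p ≤ log 2 for every prime p > D, the sequence (λ_j)_{j≥0} defined by λ₀ = D and, for j ≥ 1, λ_j = the largest prime q > λ_{j−1} with ∑_{λ_{j−1} < p ≤ q, p prime} ρ(p)/p ≤ log 2, is well-defined (for each j ≥ 1 there exists such a prime q and the set of such primes is finite), and one has 2^{j−c₅} ≤ log λ_j ≤ 2^{j+c₅} for all j ≥ 0. -/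
open Real MeasureTheory
open scoped Classical

theorem sum_primes_log_div_le (n : ℕ) :
    ∑ p ∈ (Finset.Ioc 0 n).filter Nat.Prime, Real.log p / p ≤ Real.log 4 * (2 + Real.log n) := by
  have key : ∀ n : ℕ, ∑ p ∈ (Finset.Ioc 0 n).filter Nat.Prime, Real.log p / p
      ≤ Chebyshev.theta n / n + Real.log 4 * (harmonic n : ℝ) := by
    intro n
    induction n with
    | zero => simp
    | succ n ih =>
      have h4 : 0 ≤ Real.log 4 := Real.log_nonneg (by norm_num)
      have hT : Chebyshev.theta ((n + 1 : ℕ) : ℝ)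
          = Chebyshev.theta n + if (n + 1).Prime then Real.log ((n + 1 : ℕ) : ℝ) else 0 := by
        rw [Chebyshev.theta, Chebyshev.theta, Nat.floor_natCast, Nat.floor_natCast,
          Finset.sum_filter, Finset.sum_filter,
          Finset.sum_Ioc_succ_top (Nat.zero_le n)]
      rw [Finset.sum_filter] at ih ⊢
      rw [Finset.sum_Ioc_succ_top (Nat.zero_le n), hT, harmonic_succ]
      have hth : Chebyshev.theta (n : ℝ) / n ≤
          Chebyshev.theta n / ((n + 1 : ℕ) : ℝ) + Real.log 4 * (((n + 1 : ℕ) : ℝ))⁻¹ := by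
        rcases Nat.eq_zero_or_pos n with rfl | hn
        · simp [h4]
        · have hn' : (0 : ℝ) < n := by exact_mod_cast hn
          have h1 := Chebyshev.theta_le_log4_mul_x hn'.le
          push_cast
          rw [div_add' _ _ _ (by positivity), div_le_div_iff₀ hn' (by positivity)]
          field_simp
          nlinarith
      split_ifs
      · push_cast at *
        rw [add_div, mul_add]
        linarith
      · push_cast at *
        simp only [mul_add, add_zero]
        linarith
  refine (key n).trans ?_
  have h4 : 0 ≤ Real.log 4 := Real.log_nonneg (by norm_num)
  have h1 : Chebyshev.theta (n : ℝ) / n ≤ Real.log 4 := by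
    rcases Nat.eq_zero_or_pos n with rfl | hn
    · simp [h4]
    · rw [div_le_iff₀ (by exact_mod_cast hn)]
      exact Chebyshev.theta_le_log4_mul_x (Nat.cast_nonneg n)
  have h2 := mul_le_mul_of_nonneg_left (harmonic_le_one_add_log n) h4
  linarith

theorem sum_primes_log_div_le_five_mul_log {n : ℕ} (hn : 3 ≤ n) :
    ∑ p ∈ (Finset.Ioc 0 n).filter Nat.Prime, Real.log p / p ≤ 5 * Real.log n := by
  refine (sum_primes_log_div_le n).trans ?_
  have h1 : 1 ≤ Real.log n := by
    rw [Real.le_log_iff_exp_le (by positivity)]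
    have : (3 : ℝ) ≤ n := by exact_mod_cast hn
    linarith [Real.exp_one_lt_d9]
  have h2 : Real.log 4 = 2 * Real.log 2 := by
    rw [show (4 : ℝ) = 2 ^ 2 by norm_num, Real.log_pow]; norm_num
  nlinarith [Real.log_two_lt_d9, Real.log_pos one_lt_two]

theorem sum_primes_tail_le {N n : ℕ} (hN : 3 ≤ N) :
    ∑ p ∈ (Finset.Ioc N n).filter Nat.Prime, (p : ℝ) ^ (-(1 + 1 / Real.log N)) ≤ 20 := by
  have hN1 : 1 < N := by omega
  have hlN : 1 ≤ Real.log N := by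
    rw [Real.le_log_iff_exp_le (by positivity)]
    have : (3 : ℝ) ≤ N := by exact_mod_cast hN
    linarith [Real.exp_one_lt_d9]
  have hterm : ∀ p ∈ (Finset.Ioc N n).filter Nat.Prime,
      (p : ℝ) ^ (-(1 + 1 / Real.log N)) ≤ ∑ k ∈ Finset.Ioc 0 n,
        if p ≤ N ^ (k + 1) then Real.exp (-k) / (k * Real.log N) * (Real.log p / p) else 0 := by
    intro p hp
    simp only [Finset.mem_filter, Finset.mem_Ioc] at hp
    obtain ⟨⟨hNp, hpn⟩, hp⟩ := hp
    have hp0 : (0 : ℝ) < p := by exact_mod_cast hp.pos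
    set k := Nat.log N p with hk
    have hk1 : 1 ≤ k := Nat.log_pos hN1 hNp.le
    have hkn : k ≤ n := (Nat.log_le_self N p).trans hpn
    have hlow : N ^ k ≤ p := Nat.pow_log_le_self N hp.ne_zero
    have hup : p ≤ N ^ (k + 1) := (Nat.lt_pow_succ_log_self hN1 p).le
    have hlog : k * Real.log N ≤ Real.log p := by
      rw [← Real.log_pow]
      apply Real.log_le_log (by positivity)
      exact_mod_cast hlow
    have hk0 : (1 : ℝ) ≤ k := by exact_mod_cast hk1
    have hnn : ∀ i ∈ Finset.Ioc 0 n, 0 ≤ (if p ≤ N ^ (i + 1) then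
        Real.exp (-i) / (i * Real.log N) * (Real.log p / p) else 0) := by
      intro i _
      split_ifs
      · have := Real.log_natCast_nonneg p
        positivity
      · exact le_rfl
    refine le_trans ?_ (Finset.single_le_sum hnn (Finset.mem_Ioc.2 ⟨hk1, hkn⟩))
    rw [if_pos hup, Real.rpow_def_of_pos hp0,
      show Real.log p * -(1 + 1 / Real.log N) = -Real.log p + -(Real.log p / Real.log N) by ring,
      Real.exp_add, Real.exp_neg, Real.exp_log hp0]
    have h1 : Real.exp (-(Real.log p / Real.log N)) ≤ Real.exp (-k) := by
      apply Real.exp_le_exp.2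
      rw [neg_le_neg_iff, le_div_iff₀ (by linarith)]
      exact hlog
    have h2 : 1 ≤ Real.log p / (k * Real.log N) := by
      rw [le_div_iff₀ (by positivity)]; linarith
    calc (p : ℝ)⁻¹ * Real.exp (-(Real.log p / Real.log N)) ≤ (p : ℝ)⁻¹ * Real.exp (-k) := by gcongr
      _ = (p : ℝ)⁻¹ * Real.exp (-k) * 1 := by ring
      _ ≤ (p : ℝ)⁻¹ * Real.exp (-k) * (Real.log p / (k * Real.log N)) := by gcongr
      _ = _ := by ring
  refine (Finset.sum_le_sum hterm).trans ?_
  rw [Finset.sum_comm]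
  have hk : ∀ k ∈ Finset.Ioc 0 n, (∑ p ∈ (Finset.Ioc N n).filter Nat.Prime,
      if p ≤ N ^ (k + 1) then Real.exp (-k) / (k * Real.log N) * (Real.log p / p) else 0)
      ≤ 10 * (1 / 2 : ℝ) ^ k := by
    intro k hk
    have hk1 : 1 ≤ k := (Finset.mem_Ioc.1 hk).1
    have hk0 : (1 : ℝ) ≤ k := by exact_mod_cast hk1
    rw [← Finset.sum_filter, ← Finset.mul_sum]
    have hM : ∑ p ∈ ((Finset.Ioc N n).filter Nat.Prime).filter (fun p => p ≤ N ^ (k + 1)),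
        Real.log p / p ≤ 5 * Real.log ((N ^ (k + 1) : ℕ) : ℝ) := by
      refine le_trans (Finset.sum_le_sum_of_subset_of_nonneg ?_ ?_)
        (sum_primes_log_div_le_five_mul_log (n := N ^ (k + 1))
          (hN.trans (Nat.le_self_pow (by omega) N)))
      · intro p hp
        simp only [Finset.mem_filter, Finset.mem_Ioc] at hp ⊢
        exact ⟨⟨by omega, hp.2⟩, hp.1.2⟩
      · intro p _ _
        exact div_nonneg (Real.log_natCast_nonneg p) (Nat.cast_nonneg p)
    have he : Real.exp (-(k : ℝ)) ≤ (1 / 2) ^ k := by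
      rw [← mul_neg_one, Real.exp_nat_mul]
      gcongr
      rw [Real.exp_neg, one_div]
      gcongr
      linarith [Real.exp_one_gt_d9]
    push_cast at hM
    rw [Real.log_pow] at hM
    push_cast at hM
    calc _ ≤ Real.exp (-k) / (k * Real.log N) * (5 * ((k + 1) * Real.log N)) := by gcongr
      _ = Real.exp (-k) * (5 * ((k + 1) / k)) := by field_simp
      _ ≤ (1 / 2) ^ k * (5 * 2) := by
        gcongr
        rw [div_le_iff₀ (by linarith)]; linarith
      _ = _ := by ring
  refine (Finset.sum_le_sum hk).trans ?_
  rw [← Finset.mul_sum]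
  have hgeo : ∑ k ∈ Finset.Ioc 0 n, (1 / 2 : ℝ) ^ k ≤ 2 := by
    refine (Finset.sum_le_sum_of_subset_of_nonneg (t := Finset.range (n + 1)) ?_ ?_).trans
      (sum_geometric_two_le (n + 1))
    · intro i hi
      simp only [Finset.mem_Ioc, Finset.mem_range] at hi ⊢
      omega
    · intros; positivity
  linarith

theorem sum_primes_div_sub_log_log_bounded {d : ℕ → ℝ} {G δ C : ℝ} (hδ : 0 < δ)
    (hd0 : ∀ p, 0 ≤ d p) (hdG : ∀ p, p.Prime → d p ≤ G)
    (hU : ∀ s, 1 < s → s < 1 + δ → ∀ n : ℕ,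
      ∑ p ∈ (Finset.Ioc 0 n).filter Nat.Prime, d p * (p : ℝ) ^ (-s) ≤ -Real.log (s - 1) + C)
    (hL : ∀ s, 1 < s → s < 1 + δ → ∃ n₀ : ℕ, ∀ n ≥ n₀,
      -Real.log (s - 1) - C ≤ ∑ p ∈ (Finset.Ioc 0 n).filter Nat.Prime, d p * (p : ℝ) ^ (-s)) :
    ∃ (A : ℝ) (N : ℕ), ∀ n ≥ N,
      |∑ p ∈ (Finset.Ioc 0 n).filter Nat.Prime, d p / p - Real.log (Real.log n)| ≤ A := by
  have hG0 : 0 ≤ G := (hd0 2).trans (hdG 2 Nat.prime_two)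
  refine ⟨C + 20 * G, max 3 (⌈Real.exp (1 / δ)⌉₊ + 1), fun n hn => ?_⟩
  have hn3 : 3 ≤ n := (le_max_left _ _).trans hn
  have hnexp : Real.exp (1 / δ) < n := by
    have h1 : ⌈Real.exp (1 / δ)⌉₊ + 1 ≤ n := (le_max_right _ _).trans hn
    exact (Nat.le_ceil _).trans_lt (by exact_mod_cast h1)
  have hn0 : (0 : ℝ) < n := by positivity
  have hlog : 1 / δ < Real.log n := (Real.lt_log_iff_exp_lt hn0).2 hnexp
  have hl0 : 0 < Real.log n := lt_trans (by positivity) hlog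
  have hs1 : 1 < 1 + 1 / Real.log n := by
    have : 0 < 1 / Real.log n := by positivity
    linarith
  have hs2 : 1 + 1 / Real.log n < 1 + δ := by
    have : 1 / Real.log n < δ := by
      rw [div_lt_iff₀ hl0]
      rw [div_lt_iff₀ hδ] at hlog
      linarith
    linarith
  have hls : -Real.log (1 + 1 / Real.log n - 1) = Real.log (Real.log n) := by
    rw [add_sub_cancel_left, one_div, Real.log_inv, neg_neg]
  have hU' := hU _ hs1 hs2 n
  obtain ⟨n₀, hn₀⟩ := hL _ hs1 hs2
  have hL' := hn₀ (max n₀ n) (le_max_left _ _)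
  rw [hls] at hU' hL'
  have hterm : ∀ p ∈ (Finset.Ioc 0 n).filter Nat.Prime,
      d p / p ≤ d p * (p : ℝ) ^ (-(1 + 1 / Real.log n)) +
        G / Real.log n * (Real.log p / p) := by
    intro p hp
    have hpp := (Finset.mem_filter.1 hp).2
    have hp0 : (0 : ℝ) < p := by exact_mod_cast hpp.pos
    rw [Real.rpow_def_of_pos hp0,
      show Real.log p * -(1 + 1 / Real.log n) = -Real.log p + -(Real.log p / Real.log n) by ring,
      Real.exp_add, Real.exp_neg, Real.exp_log hp0]
    have h1 := Real.add_one_le_exp (-(Real.log p / Real.log n))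
    have hlp := Real.log_natCast_nonneg p
    have h2 : d p * (p : ℝ)⁻¹ * (-(Real.log p / Real.log n) + 1) ≤
        d p * (p : ℝ)⁻¹ * Real.exp (-(Real.log p / Real.log n)) := by
      have := hd0 p
      gcongr
    have h3 : d p * ((p : ℝ)⁻¹ * (Real.log p / Real.log n)) ≤
        G * ((p : ℝ)⁻¹ * (Real.log p / Real.log n)) := by
      gcongr
      exact hdG p hpp
    have e1 : d p / p = d p * (p : ℝ)⁻¹ := div_eq_mul_inv _ _
    have e2 : G / Real.log n * (Real.log p / p) = G * ((p : ℝ)⁻¹ * (Real.log p / Real.log n)) := by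
      field_simp
    rw [e1, e2]
    linarith
  have hup := Finset.sum_le_sum hterm
  rw [Finset.sum_add_distrib, ← Finset.mul_sum] at hup
  have hM : G / Real.log n * ∑ p ∈ (Finset.Ioc 0 n).filter Nat.Prime, Real.log p / p ≤ 5 * G := by
    calc _ ≤ G / Real.log n * (5 * Real.log n) := by
          have := sum_primes_log_div_le_five_mul_log hn3
          gcongr
      _ = _ := by field_simp
  have hsplit : (Finset.Ioc 0 (max n₀ n)).filter Nat.Prime =
      (Finset.Ioc 0 n).filter Nat.Prime ∪ (Finset.Ioc n (max n₀ n)).filter Nat.Prime := by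
    rw [← Finset.filter_union, Finset.Ioc_union_Ioc_eq_Ioc (Nat.zero_le n) (le_max_right _ _)]
  have hdisj : Disjoint ((Finset.Ioc 0 n).filter Nat.Prime)
      ((Finset.Ioc n (max n₀ n)).filter Nat.Prime) :=
    Finset.disjoint_filter_filter (Finset.Ioc_disjoint_Ioc_of_le le_rfl)
  rw [hsplit, Finset.sum_union hdisj] at hL'
  have ht1 : ∑ p ∈ (Finset.Ioc n (max n₀ n)).filter Nat.Prime,
      d p * (p : ℝ) ^ (-(1 + 1 / Real.log n)) ≤ G * 20 := by
    refine le_trans ?_ (mul_le_mul_of_nonneg_left (sum_primes_tail_le (n := max n₀ n) hn3) hG0)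
    rw [Finset.mul_sum]
    refine Finset.sum_le_sum fun p hp => ?_
    have := hdG p (Finset.mem_filter.1 hp).2
    gcongr
  have ht2 : ∑ p ∈ (Finset.Ioc 0 n).filter Nat.Prime, d p * (p : ℝ) ^ (-(1 + 1 / Real.log n)) ≤
      ∑ p ∈ (Finset.Ioc 0 n).filter Nat.Prime, d p / p := by
    refine Finset.sum_le_sum fun p hp => ?_
    have hpp := (Finset.mem_filter.1 hp).2
    have hp1 : (1 : ℝ) ≤ p := by exact_mod_cast hpp.one_lt.le
    rw [div_eq_mul_inv (d p), ← Real.rpow_neg_one (p : ℝ)]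
    have := hd0 p
    gcongr
  rw [abs_le]
  constructor <;> linarith

theorem exists_seq_of_sum_primes_div {r : ℕ → ℝ} {G A : ℝ} {N : ℕ}
    (hr0 : ∀ p, 0 ≤ r p) (hrG : ∀ p, p.Prime → r p ≤ G)
    (hA : ∀ n ≥ N,
      |∑ p ∈ (Finset.Ioc 0 n).filter Nat.Prime, r p / p - Real.log (Real.log n)| ≤ A) :
    ∃ (D : ℕ) (c : ℝ) (lam : ℕ → ℕ), 2 ≤ D ∧ 0 < c ∧
      (∀ p : ℕ, p.Prime → D < p → r p / p ≤ Real.log 2) ∧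
      lam 0 = D ∧
      (∀ j : ℕ, 1 ≤ j →
        ((lam j).Prime ∧ lam (j - 1) < lam j ∧
          ∑ p ∈ (Finset.Ioc (lam (j - 1)) (lam j)).filter Nat.Prime, r p / p ≤ Real.log 2) ∧
        (∀ q : ℕ, q.Prime → lam (j - 1) < q →
          (∑ p ∈ (Finset.Ioc (lam (j - 1)) q).filter Nat.Prime, r p / p ≤ Real.log 2) →
            q ≤ lam j)) ∧
      ∀ j : ℕ, (2 : ℝ) ^ ((j : ℝ) - c) ≤ Real.log (lam j) ∧
        Real.log (lam j) ≤ (2 : ℝ) ^ ((j : ℝ) + c) := by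
  have hG0 : 0 ≤ G := (hr0 2).trans (hrG 2 Nat.prime_two)
  have hl2 : 0 < Real.log 2 := Real.log_pos one_lt_two
  set S : ℕ → ℝ := fun n => ∑ p ∈ (Finset.Ioc 0 n).filter Nat.Prime, r p / p with hS
  have hSadd : ∀ a b : ℕ, a ≤ b →
      ∑ p ∈ (Finset.Ioc a b).filter Nat.Prime, r p / p = S b - S a := by
    intro a b hab
    have h : (Finset.Ioc 0 b).filter Nat.Prime =
        (Finset.Ioc 0 a).filter Nat.Prime ∪ (Finset.Ioc a b).filter Nat.Prime := by
      rw [← Finset.filter_union, Finset.Ioc_union_Ioc_eq_Ioc (Nat.zero_le a) hab]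
    simp only [hS]
    rw [h, Finset.sum_union
      (Finset.disjoint_filter_filter (Finset.Ioc_disjoint_Ioc_of_le le_rfl))]
    ring
  have hSmono : Monotone S := by
    intro a b hab
    have h := hSadd a b hab
    have : 0 ≤ ∑ p ∈ (Finset.Ioc a b).filter Nat.Prime, r p / p :=
      Finset.sum_nonneg fun p _ => div_nonneg (hr0 p) (Nat.cast_nonneg p)
    linarith
  have hStop : Filter.Tendsto S Filter.atTop Filter.atTop := by
    have h1 : Filter.Tendsto (fun n : ℕ => Real.log (Real.log n) - A) Filter.atTop Filter.atTop :=
      Filter.tendsto_atTop_add_const_right _ _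
        (Real.tendsto_log_atTop.comp (Real.tendsto_log_atTop.comp tendsto_natCast_atTop_atTop))
    refine Filter.tendsto_atTop_mono' _ ?_ h1
    filter_upwards [Filter.eventually_ge_atTop N] with n hn
    have := (abs_le.1 (hA n hn)).1
    simp only [hS]
    linarith
  obtain ⟨D, hD3, hDN, hDG⟩ : ∃ D : ℕ, 3 ≤ D ∧ N ≤ D ∧ 2 * G / Real.log 2 ≤ D :=
    ⟨max (max 3 N) ⌈2 * G / Real.log 2⌉₊, (le_max_left _ _).trans (le_max_left _ _),
      (le_max_right _ _).trans (le_max_left _ _),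
      (Nat.le_ceil _).trans (by exact_mod_cast le_max_right _ _)⟩
  have hsmall : ∀ m p : ℕ, p.Prime → D ≤ m → m < p →
      r p / p ≤ G / m ∧ G / m ≤ Real.log 2 / 2 := by
    intro m p hp hDm hmp
    have hm0 : (0 : ℝ) < m := by exact_mod_cast (show 0 < m by omega)
    have hmp' : (m : ℝ) ≤ p := by exact_mod_cast hmp.le
    refine ⟨div_le_div₀ hG0 (hrG p hp) hm0 hmp', ?_⟩
    have hDm' : (D : ℝ) ≤ m := by exact_mod_cast hDm
    rw [div_le_iff₀ hl2] at hDG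
    rw [div_le_iff₀ hm0]
    nlinarith
  have hstep : ∀ m : ℕ, ∃ q : ℕ, D ≤ m → (q.Prime ∧ m < q ∧ S q - S m ≤ Real.log 2 ∧
      (∀ q' : ℕ, q'.Prime → m < q' → S q' - S m ≤ Real.log 2 → q' ≤ q) ∧
      Real.log 2 - G / q ≤ S q - S m) := by
    intro m
    by_cases hm : D ≤ m
    swap
    · exact ⟨0, fun h => absurd h hm⟩
    have hnext : ∀ a : ℕ, D ≤ a → ∃ p : ℕ, p.Prime ∧ a < p ∧ S p - S a = r p / p := by
      intro a ha
      have hex : ∃ p : ℕ, p.Prime ∧ a < p := by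
        obtain ⟨p, h1, h2⟩ := Nat.exists_infinite_primes (a + 1)
        exact ⟨p, h2, h1⟩
      refine ⟨Nat.find hex, (Nat.find_spec hex).1, (Nat.find_spec hex).2, ?_⟩
      obtain ⟨h1, h2⟩ := Nat.find_spec hex
      rw [← hSadd _ _ h2.le]
      refine Finset.sum_eq_single_of_mem _ (by simp [h1, h2]) ?_
      intro b hb hne
      exfalso
      simp only [Finset.mem_filter, Finset.mem_Ioc] at hb
      exact Nat.find_min hex (lt_of_le_of_ne hb.1.2 hne) ⟨hb.2, hb.1.1⟩
    obtain ⟨B, hB⟩ := Filter.eventually_atTop.1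
      (hStop.eventually (Filter.eventually_gt_atTop (S m + Real.log 2)))
    set P : ℕ → Prop := fun q => q.Prime ∧ m < q ∧ S q - S m ≤ Real.log 2 with hP
    have hbd : ∀ q, P q → q ≤ B := by
      intro q hq
      by_contra hcon
      have := hB q (by omega)
      linarith [hq.2.2]
    obtain ⟨p, hp1, hp2, hp3⟩ := hnext m hm
    have hPp : P p := ⟨hp1, hp2, by
      have := hsmall m p hp1 hm hp2
      linarith [this.1, this.2]⟩
    have hspec : P (Nat.findGreatest P B) := Nat.findGreatest_spec (hbd p hPp) hPp
    refine ⟨Nat.findGreatest P B, fun _ => ⟨hspec.1, hspec.2.1, hspec.2.2, ?_, ?_⟩⟩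
    · intro q' h1 h2 h3
      exact Nat.le_findGreatest (hbd q' ⟨h1, h2, h3⟩) ⟨h1, h2, h3⟩
    · set q := Nat.findGreatest P B with hq
      have hDq : D ≤ q := hm.trans hspec.2.1.le
      obtain ⟨p', hp1', hp2', hp3'⟩ := hnext q hDq
      by_contra hcon
      have h4 := (hsmall q p' hp1' hDq hp2').1
      have hPp' : P p' := ⟨hp1', hspec.2.1.trans hp2', by linarith⟩
      have : p' ≤ q := Nat.le_findGreatest (hbd p' hPp') hPp'
      omega
  choose nx hnx using hstep
  set lam : ℕ → ℕ := fun j => Nat.rec D (fun _ m => nx m) j with hlam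
  have hlam0 : lam 0 = D := rfl
  have hlams : ∀ j, lam (j + 1) = nx (lam j) := fun j => rfl
  have hlamD : ∀ j, D ≤ lam j := by
    intro j
    induction j with
    | zero => exact le_rfl
    | succ j ih => rw [hlams]; exact ih.trans (hnx _ ih).2.1.le
  have hlog1 : ∀ j, 1 ≤ Real.log (lam j) := by
    intro j
    have h3 : (3 : ℝ) ≤ lam j := by exact_mod_cast hD3.trans (hlamD j)
    rw [Real.le_log_iff_exp_le (by linarith)]
    linarith [Real.exp_one_lt_d9]
  have hAlam : ∀ j, |S (lam j) - Real.log (Real.log (lam j))| ≤ A :=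
    fun j => hA _ (hDN.trans (hlamD j))
  have hSup : ∀ j : ℕ, S (lam j) - S D ≤ j * Real.log 2 := by
    intro j
    induction j with
    | zero => simp [hlam0]
    | succ j ih =>
      have := (hnx _ (hlamD j)).2.2.1
      rw [← hlams] at this
      push_cast
      linarith
  have hSlow : ∀ j : ℕ, j * (Real.log 2 / 2) ≤ S (lam j) - S D := by
    intro j
    induction j with
    | zero => simp [hlam0]
    | succ j ih =>
      have h1 := (hnx _ (hlamD j)).2.2.2.2
      rw [← hlams] at h1
      obtain ⟨p, hp1, hp2⟩ := Nat.exists_infinite_primes (lam (j + 1) + 1)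
      have h2 := (hsmall (lam (j + 1)) p hp2 (hlamD (j + 1)) (by omega)).2
      push_cast
      linarith
  set E := Real.exp (A - S D) with hE
  set x : ℝ := Real.exp (-(Real.log 2 / 2)) with hx
  have hx0 : 0 < x := Real.exp_pos _
  have hx1 : x < 1 := by rw [hx, Real.exp_lt_one_iff]; linarith
  have hinv : ∀ j : ℕ, 1 / (lam j : ℝ) ≤ E * x ^ j := by
    intro j
    have h1 := (abs_le.1 (hAlam j)).2
    have h2 := hSlow j
    have hpos : (0 : ℝ) < lam j := by
      exact_mod_cast (show 0 < lam j by have := hlamD j; omega)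
    have h3 : Real.log (Real.log (lam j)) ≤ Real.log (lam j) :=
      (Real.log_le_sub_one_of_pos (by linarith [hlog1 j])).trans (by linarith)
    rw [one_div, ← Real.exp_log hpos, ← Real.exp_neg, hE, hx, ← Real.exp_nat_mul, ← Real.exp_add]
    apply Real.exp_le_exp.2
    linarith
  have hSlow2 : ∀ j : ℕ, j * Real.log 2 - G * E * ∑ i ∈ Finset.range (j + 1), x ^ i ≤
      S (lam j) - S D := by
    intro j
    induction j with
    | zero => simp [hlam0]; positivity
    | succ j ih =>
      have h1 := (hnx _ (hlamD j)).2.2.2.2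
      rw [← hlams] at h1
      have h2 := mul_le_mul_of_nonneg_left (hinv (j + 1)) hG0
      rw [Finset.sum_range_succ]
      push_cast
      have h3 : G / (lam (j + 1) : ℝ) = G * (1 / (lam (j + 1) : ℝ)) := by ring
      rw [h3] at h1
      linarith
  have hgeo : ∀ j : ℕ, ∑ i ∈ Finset.range j, x ^ i ≤ (1 - x)⁻¹ := by
    intro j
    rw [← tsum_geometric_of_lt_one hx0.le hx1]
    exact (summable_geometric_of_lt_one hx0.le hx1).sum_le_tsum _ fun i _ => by positivity
  set M : ℝ := A + |S D| + G * E * (1 - x)⁻¹ with hM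
  have hA0 : 0 ≤ A := (abs_nonneg _).trans (hAlam 0)
  have hx1' : 0 < 1 - x := by linarith
  have hM0 : 0 ≤ M := by positivity
  have hfin : ∀ j : ℕ, |Real.log (Real.log (lam j)) - j * Real.log 2| ≤ M := by
    intro j
    have h1 := abs_le.1 (hAlam j)
    have h2 := hSup j
    have h3 := hSlow2 j
    have h4 := mul_le_mul_of_nonneg_left (hgeo (j + 1)) (show 0 ≤ G * E by positivity)
    have h5 := neg_abs_le (S D)
    have h6 := le_abs_self (S D)
    have h7 : 0 ≤ G * E * (1 - x)⁻¹ := by positivity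
    rw [abs_le]
    constructor <;> linarith [h1.1, h1.2]
  refine ⟨D, M / Real.log 2 + 1, lam, by omega, by positivity, ?_, rfl, ?_, ?_⟩
  · intro p hp hDp
    have := hsmall D p hp le_rfl hDp
    linarith [this.1, this.2]
  · intro j hj
    obtain ⟨i, rfl⟩ : ∃ i, j = i + 1 := ⟨j - 1, by omega⟩
    obtain ⟨h1, h2, h3, h4, -⟩ := hnx _ (hlamD i)
    rw [Nat.add_sub_cancel, hlams]
    refine ⟨⟨h1, h2, ?_⟩, ?_⟩
    · rw [hSadd _ _ h2.le]; exact h3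
    · intro q hq1 hq2 hq3
      rw [hSadd _ _ hq2.le] at hq3
      exact h4 q hq1 hq2 hq3
  · intro j
    have hpos : 0 < Real.log (lam j) := by linarith [hlog1 j]
    have h := abs_le.1 (hfin j)
    have e : Real.log 2 * (M / Real.log 2) = M := by field_simp
    constructor
    · rw [Real.rpow_def_of_pos two_pos, ← Real.le_log_iff_exp_le hpos]
      linarith [h.1]
    · rw [Real.rpow_def_of_pos two_pos, ← Real.log_le_iff_le_exp hpos]
      linarith [h.2]

section NumberField

open NumberField

variable (K : Type*) [Field K] [NumberField K]

/-- The primes of `𝓞 K` over the rational number `p`. -/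
noncomputable def primesAbove (p : ℕ) : Finset (Ideal (𝓞 K)) :=
  IsDedekindDomain.primesOverFinset (Ideal.span {(p : ℤ)}) (𝓞 K)

/-- The number of primes of `𝓞 K` over `p` whose norm is `p`. -/
noncomputable def degreeOneCount (p : ℕ) : ℕ :=
  ((primesAbove K p).filter (fun P => Ideal.absNorm P = p)).card

/-- The Dedekind zeta function of `K` on the real line, as a real series. -/
noncomputable def realZeta (s : ℝ) : ℝ :=
  ∑' n : ℕ, (Nat.card {I : Ideal (𝓞 K) // Ideal.absNorm I = n} : ℝ) * (n : ℝ) ^ (-s)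

variable {K}

theorem mem_primesAbove {p : ℕ} (hp : p.Prime) {P : Ideal (𝓞 K)} :
    P ∈ primesAbove K p ↔ P ∈ Ideal.primesOver (Ideal.span {(p : ℤ)}) (𝓞 K) := by
  have := Fact.mk hp
  exact IsDedekindDomain.mem_primesOverFinset_iff (by simp [hp.ne_zero]) _

theorem exists_absNorm_eq_pow {p : ℕ} (hp : p.Prime) {P : Ideal (𝓞 K)} (hP : P ∈ primesAbove K p) :
    P.IsPrime ∧ P ≠ ⊥ ∧ ∃ f, 1 ≤ f ∧ Ideal.absNorm P = p ^ f := by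
  obtain ⟨h1, h2⟩ := (mem_primesAbove hp).1 hP
  have h3 := Ideal.pow_inertiaDeg p P
  refine ⟨h1, ?_, P.inertiaDeg ℤ, Ideal.inertiaDeg_pos P ℤ, h3.symm⟩
  rintro rfl
  rw [Ideal.absNorm_bot] at h3
  exact hp.ne_zero (pow_eq_zero_iff (Ideal.inertiaDeg_pos _ ℤ).ne' |>.1 h3)

theorem exists_mem_primesAbove {P : Ideal (𝓞 K)} (hP : P.IsPrime) (hP0 : P ≠ ⊥) :
    ∃ p : ℕ, p.Prime ∧ p ∣ Ideal.absNorm P ∧ P ∈ primesAbove K p := by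
  have : NeZero P := ⟨hP0⟩
  have h := Nat.absNorm_under_prime P
  refine ⟨_, h, Int.absNorm_under_dvd_absNorm P, (mem_primesAbove h).2 ⟨hP, ⟨?_⟩⟩⟩
  rw [Int.ideal_span_absNorm_eq_self]

theorem disjoint_primesAbove {p q : ℕ} (hp : p.Prime) (hq : q.Prime) (hpq : p ≠ q) :
    Disjoint (primesAbove K p) (primesAbove K q) := by
  rw [Finset.disjoint_left]
  intro P h1 h2
  obtain ⟨-, -, f, hf, e1⟩ := exists_absNorm_eq_pow hp h1
  obtain ⟨-, -, f', -, e2⟩ := exists_absNorm_eq_pow hq h2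
  have h3 : p ∣ q ^ f' := by rw [← e2, e1]; exact dvd_pow_self p (by omega)
  exact hpq ((Nat.prime_dvd_prime_iff_eq hp hq).1 (hp.dvd_of_dvd_pow h3))

theorem card_primesAbove_le {p : ℕ} (hp : p.Prime) :
    (primesAbove K p).card ≤ Module.finrank ℤ (𝓞 K) := by
  have := Fact.mk hp
  have hbij : (primesAbove K p).card =
      Fintype.card (Ideal.primesOver (Ideal.span {(p : ℤ)}) (𝓞 K)) := by
    rw [← Fintype.card_coe]
    exact Fintype.card_congr (Equiv.subtypeEquivRight fun P => mem_primesAbove hp)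
  rw [hbij, ← Ideal.sum_ramification_inertia_eq_finrank (R := ℤ) (S := 𝓞 K)
    (p := Ideal.span {(p : ℤ)}), ← Finset.card_univ, Finset.card_eq_sum_ones]
  refine Finset.sum_le_sum fun P _ => ?_
  have : P.1.IsPrime := P.2.1
  exact Nat.one_le_iff_ne_zero.2
    (mul_ne_zero (Ideal.ramificationIdx_pos P.1 ℤ).ne' (Ideal.inertiaDeg_pos P.1 ℤ).ne')

theorem degreeOneCount_le {p : ℕ} (hp : p.Prime) :
    degreeOneCount K p ≤ Module.finrank ℤ (𝓞 K) :=
  (Finset.card_filter_le _ _).trans (card_primesAbove_le hp)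

theorem realZeta_bounds : ∃ δ c C : ℝ, 0 < δ ∧ 0 < c ∧ 0 < C ∧ ∀ s : ℝ, 1 < s → s < 1 + δ →
    (Summable fun n : ℕ =>
      (Nat.card {I : Ideal (𝓞 K) // Ideal.absNorm I = n} : ℝ) * (n : ℝ) ^ (-s)) ∧
    c / (s - 1) ≤ realZeta K s ∧ realZeta K s ≤ C / (s - 1) := by
  set κ := dedekindZeta_residue K with hκ
  have hκ0 : 0 < κ := dedekindZeta_residue_pos K
  have hlim := (tendsto_sub_one_mul_dedekindZeta_nhdsGT K).norm
  have hn : ‖(dedekindZeta_residue K : ℂ)‖ = κ := by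
    rw [Complex.norm_real, Real.norm_of_nonneg hκ0.le]
  rw [hn] at hlim
  have hev := hlim.eventually (Ioo_mem_nhds (show κ / 2 < κ by linarith) (show κ < 2 * κ by linarith))
  obtain ⟨u, hu1, hu⟩ := mem_nhdsGT_iff_exists_Ioo_subset.1 hev
  refine ⟨u - 1, κ / 2, 2 * κ, sub_pos.2 hu1, by positivity, by positivity, fun s hs1 hs2 => ?_⟩
  have hs := hu (show s ∈ Set.Ioo 1 u from ⟨hs1, by linarith⟩)
  simp only [Set.mem_ofPred_eq] at hs
  have hs0 : (s : ℂ) ≠ 0 := by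
    exact_mod_cast (show s ≠ 0 by linarith)
  have hs1' : 0 < s - 1 := by linarith
  have hterm : LSeries.term (fun n ↦ (Nat.card {I : Ideal (𝓞 K) // Ideal.absNorm I = n} : ℂ)) s =
      fun n : ℕ => (((Nat.card {I : Ideal (𝓞 K) // Ideal.absNorm I = n} : ℝ) *
        (n : ℝ) ^ (-s) : ℝ) : ℂ) := by
    funext n
    rw [LSeries.term_of_ne_zero' hs0, Complex.ofReal_mul, Complex.ofReal_cpow (Nat.cast_nonneg n)]
    push_cast
    rw [Complex.cpow_neg, div_eq_mul_inv]
  have hval : dedekindZeta K s = ((realZeta K s : ℝ) : ℂ) := by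
    rw [dedekindZeta, LSeries, hterm, ← Complex.ofReal_tsum]
    rfl
  rw [hval] at hs
  have hnn : 0 ≤ realZeta K s := tsum_nonneg fun n => by positivity
  have hnorm : ‖((s : ℂ) - 1) * ((realZeta K s : ℝ) : ℂ)‖ = (s - 1) * realZeta K s := by
    rw [← Complex.ofReal_one, ← Complex.ofReal_sub, ← Complex.ofReal_mul, Complex.norm_real,
      Real.norm_of_nonneg (by positivity)]
  rw [hnorm] at hs
  refine ⟨?_, ?_, ?_⟩
  · by_contra hns
    have : realZeta K s = 0 := tsum_eq_zero_of_not_summable hns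
    rw [this] at hs
    linarith [hs.1, mul_zero (s - 1)]
  · rw [div_le_iff₀ hs1']; linarith [hs.1]
  · rw [le_div_iff₀ hs1']; linarith [hs.2]

theorem sum_absNorm_rpow_le_realZeta {s : ℝ}
    (hsum : Summable fun n : ℕ =>
      (Nat.card {I : Ideal (𝓞 K) // Ideal.absNorm I = n} : ℝ) * (n : ℝ) ^ (-s))
    (T : Finset (Ideal (𝓞 K))) :
    ∑ I ∈ T, (Ideal.absNorm I : ℝ) ^ (-s) ≤ realZeta K s := by
  have h1 : ∑ I ∈ T, (Ideal.absNorm I : ℝ) ^ (-s) =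
      ∑ n ∈ T.image Ideal.absNorm, ((T.filter (fun I => Ideal.absNorm I = n)).card : ℝ) *
        (n : ℝ) ^ (-s) := by
    rw [← Finset.sum_fiberwise_of_maps_to (g := Ideal.absNorm) (t := T.image Ideal.absNorm)
      (fun I hI => Finset.mem_image_of_mem _ hI)]
    refine Finset.sum_congr rfl fun n _ => ?_
    rw [← nsmul_eq_mul]
    refine Finset.sum_eq_card_nsmul fun I hI => ?_
    rw [(Finset.mem_filter.1 hI).2]
  rw [h1]
  refine le_trans (Finset.sum_le_sum fun n _ => ?_)
    (hsum.sum_le_tsum (T.image Ideal.absNorm) fun n _ => by positivity)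
  gcongr
  have hfin := Ideal.finite_setOfPred_absNorm_eq (S := 𝓞 K) n
  have : Finite {I : Ideal (𝓞 K) // Ideal.absNorm I = n} := hfin
  rw [← Nat.card_eq_finsetCard]
  exact Nat.card_le_card_of_injective
    (fun I => (⟨I.1, (Finset.mem_filter.1 I.2).2⟩ : {I : Ideal (𝓞 K) // Ideal.absNorm I = n}))
    (fun I J h => Subtype.ext (by simpa using h))

theorem prod_one_add_absNorm_rpow_le_realZeta {s : ℝ}
    (hsum : Summable fun n : ℕ =>
      (Nat.card {I : Ideal (𝓞 K) // Ideal.absNorm I = n} : ℝ) * (n : ℝ) ^ (-s))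
    {S : Finset (Ideal (𝓞 K))} (hS : ∀ P ∈ S, P.IsPrime ∧ P ≠ ⊥) :
    ∏ P ∈ S, (1 + (Ideal.absNorm P : ℝ) ^ (-s)) ≤ realZeta K s := by
  have hmem : ∀ t ∈ S.powerset, ∀ P ∈ S, P ∣ ∏ Q ∈ t, Q ↔ P ∈ t := by
    intro t ht P hP
    refine ⟨fun h => ?_, fun h => Finset.dvd_prod_of_mem _ h⟩
    have hPp := Ideal.prime_of_isPrime (hS P hP).2 (hS P hP).1
    obtain ⟨Q, hQ, hPQ⟩ := (hPp.dvd_finsetProd_iff _).1 h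
    have hQS := Finset.mem_powerset.1 ht hQ
    have hQp := Ideal.prime_of_isPrime (hS Q hQS).2 (hS Q hQS).1
    have : P = Q := associated_iff_eq.1 ((hPp.dvd_prime_iff_associated hQp).1 hPQ)
    rwa [this]
  have hinj : Set.InjOn (fun t : Finset (Ideal (𝓞 K)) => ∏ Q ∈ t, Q) S.powerset := by
    intro t ht t' ht' h
    have h' : ∏ Q ∈ t, Q = ∏ Q ∈ t', Q := h
    ext P
    constructor
    · intro hP
      have hPS := Finset.mem_powerset.1 ht hP
      rwa [← hmem t' ht' P hPS, ← h', hmem t ht P hPS]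
    · intro hP
      have hPS := Finset.mem_powerset.1 ht' hP
      rwa [← hmem t ht P hPS, h', hmem t' ht' P hPS]
  rw [Finset.prod_one_add]
  refine le_trans (le_of_eq ?_)
    (sum_absNorm_rpow_le_realZeta hsum (S.powerset.image fun t => ∏ Q ∈ t, Q))
  rw [Finset.sum_image hinj]
  refine Finset.sum_congr rfl fun t _ => ?_
  rw [map_prod, Nat.cast_prod, Real.finsetProd_rpow _ _ fun _ _ => Nat.cast_nonneg _]

theorem sum_absNorm_rpow_le_prod {s : ℝ} (hs : 0 < s) {T S : Finset (Ideal (𝓞 K))}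
    (hS : ∀ P ∈ S, P.IsPrime ∧ P ≠ ⊥)
    (hT : ∀ I ∈ T, I ≠ ⊥ ∧ ∀ P : Ideal (𝓞 K), P.IsPrime → P ≠ ⊥ → P ∣ I → P ∈ S) :
    ∑ I ∈ T, (Ideal.absNorm I : ℝ) ^ (-s) ≤
      ∏ P ∈ S, (1 - (Ideal.absNorm P : ℝ) ^ (-s))⁻¹ := by
  set cnt : Ideal (𝓞 K) → S → ℕ :=
    fun I P => (UniqueFactorizationMonoid.normalizedFactors I).count P.1 with hcnt
  set g : (S → ℕ) → ℝ := fun e => ∏ P : S, ((Ideal.absNorm P.1 : ℝ) ^ (-s)) ^ e P with hg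
  have hfac : ∀ I ∈ T, I = ∏ P : S, P.1 ^ cnt I P := by
    intro I hI
    obtain ⟨hI0, hIS⟩ := hT I hI
    have h1 := Ideal.prod_normalizedFactors_eq_self hI0
    have hsub : (UniqueFactorizationMonoid.normalizedFactors I).toFinset ⊆ S := by
      intro P hP
      have hP' := Multiset.mem_toFinset.1 hP
      have hpr := UniqueFactorizationMonoid.prime_of_normalized_factor P hP'
      exact hIS P (Ideal.isPrime_of_prime hpr) hpr.ne_zero
        (UniqueFactorizationMonoid.dvd_of_mem_normalizedFactors hP')
    rw [Finset.prod_multiset_count_of_subset _ S hsub] at h1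
    rw [Finset.prod_coe_sort S
      (fun P => P ^ (UniqueFactorizationMonoid.normalizedFactors I).count P)]
    exact h1.symm
  have hval : ∀ I ∈ T, (Ideal.absNorm I : ℝ) ^ (-s) = g (cnt I) := by
    intro I hI
    conv_lhs => rw [hfac I hI]
    rw [map_prod, Nat.cast_prod, ← Real.finsetProd_rpow _ _ fun _ _ => Nat.cast_nonneg _]
    refine Finset.prod_congr rfl fun P _ => ?_
    rw [map_pow, Nat.cast_pow, ← Real.rpow_natCast, ← Real.rpow_natCast,
      ← Real.rpow_mul (Nat.cast_nonneg _), ← Real.rpow_mul (Nat.cast_nonneg _), mul_comm]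
  have hinj : Set.InjOn cnt T := by
    intro I hI J hJ h
    rw [hfac I hI, hfac J hJ, h]
  set E : ℕ := (T.sup fun I => Finset.univ.sup (cnt I)) + 1 with hE
  have hmaps : T.image cnt ⊆ Fintype.piFinset fun _ : S => Finset.range E := by
    intro e he
    obtain ⟨I, hI, rfl⟩ := Finset.mem_image.1 he
    rw [Fintype.mem_piFinset]
    intro P
    rw [Finset.mem_range, hE, Nat.lt_succ_iff]
    exact (Finset.le_sup (f := cnt I) (Finset.mem_univ P)).trans
      (Finset.le_sup (f := fun I => Finset.univ.sup (cnt I)) hI)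
  have hx : ∀ P ∈ S, 0 ≤ (Ideal.absNorm P : ℝ) ^ (-s) ∧ (Ideal.absNorm P : ℝ) ^ (-s) < 1 := by
    intro P hP
    refine ⟨by positivity, Real.rpow_lt_one_of_one_lt_of_neg ?_ (by linarith)⟩
    have h0 : Ideal.absNorm P ≠ 0 := fun h => (hS P hP).2 (Ideal.absNorm_eq_zero_iff.1 h)
    have h1 : Ideal.absNorm P ≠ 1 := fun h => (hS P hP).1.ne_top (Ideal.absNorm_eq_one_iff.1 h)
    exact_mod_cast (show 1 < Ideal.absNorm P by omega)
  calc ∑ I ∈ T, (Ideal.absNorm I : ℝ) ^ (-s) = ∑ I ∈ T, g (cnt I) := Finset.sum_congr rfl hval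
    _ = ∑ e ∈ T.image cnt, g e := (Finset.sum_image hinj).symm
    _ ≤ ∑ e ∈ Fintype.piFinset fun _ : S => Finset.range E, g e :=
        Finset.sum_le_sum_of_subset_of_nonneg hmaps fun e _ _ =>
          Finset.prod_nonneg fun P _ => by positivity
    _ = ∏ P : S, ∑ j ∈ Finset.range E, ((Ideal.absNorm P.1 : ℝ) ^ (-s)) ^ j :=
        (Finset.prod_univ_sum (fun _ : S => Finset.range E)
          (fun P j => ((Ideal.absNorm P.1 : ℝ) ^ (-s)) ^ j)).symm
    _ ≤ ∏ P : S, (1 - (Ideal.absNorm P.1 : ℝ) ^ (-s))⁻¹ := by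
        refine Finset.prod_le_prod (fun P _ => Finset.sum_nonneg fun _ _ => by positivity)
          fun P _ => ?_
        obtain ⟨h0, h1⟩ := hx P.1 P.2
        rw [← tsum_geometric_of_lt_one h0 h1]
        exact (summable_geometric_of_lt_one h0 h1).sum_le_tsum _ fun i _ => by positivity
    _ = _ := Finset.prod_coe_sort S (fun P => (1 - (Ideal.absNorm P : ℝ) ^ (-s))⁻¹)

theorem rpow_neg_le_inv_of_one_lt {x s : ℝ} (hx : 1 ≤ x) (hs : 1 < s) : x ^ (-s) ≤ x⁻¹ := by
  rw [← Real.rpow_neg_one]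
  exact Real.rpow_le_rpow_of_exponent_le hx (by linarith)

theorem sum_primes_inv_sq_le (n : ℕ) :
    ∑ p ∈ (Finset.Ioc 0 n).filter Nat.Prime, (((p : ℝ)⁻¹) ^ 2) ≤ ∑' m : ℕ, ((m : ℝ)⁻¹) ^ 2 := by
  have h : Summable fun m : ℕ => ((m : ℝ)⁻¹) ^ 2 := by
    simp [inv_pow]
  exact h.sum_le_tsum _ fun m _ => by positivity

theorem sum_degreeOneCount_le_log_realZeta {s : ℝ} (hs : 1 < s)
    (hsum : Summable fun n : ℕ =>
      (Nat.card {I : Ideal (𝓞 K) // Ideal.absNorm I = n} : ℝ) * (n : ℝ) ^ (-s)) (n : ℕ) :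
    ∑ p ∈ (Finset.Ioc 0 n).filter Nat.Prime, (degreeOneCount K p : ℝ) * (p : ℝ) ^ (-s) ≤
      Real.log (realZeta K s) + Module.finrank ℤ (𝓞 K) * ∑' m : ℕ, ((m : ℝ)⁻¹) ^ 2 := by
  set A := (Finset.Ioc 0 n).filter Nat.Prime with hA
  have hAp : ∀ p ∈ A, p.Prime := fun p hp => (Finset.mem_filter.1 hp).2
  set S : ℕ → Finset (Ideal (𝓞 K)) :=
    fun p => (primesAbove K p).filter (fun P => Ideal.absNorm P = p) with hS
  have hprod := prod_one_add_absNorm_rpow_le_realZeta (s := s) hsum (S := A.biUnion S) (by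
    intro P hP
    obtain ⟨p, hp, hPp⟩ := Finset.mem_biUnion.1 hP
    obtain ⟨h1, h2, -⟩ := exists_absNorm_eq_pow (hAp p hp) (Finset.mem_filter.1 hPp).1
    exact ⟨h1, h2⟩)
  rw [Finset.prod_biUnion (fun p hp q hq hpq => Finset.disjoint_of_subset_left
    (Finset.filter_subset _ _) (Finset.disjoint_of_subset_right (Finset.filter_subset _ _)
      (disjoint_primesAbove (hAp p hp) (hAp q hq) hpq)))] at hprod
  have hinner : ∀ p ∈ A, ∏ P ∈ S p, (1 + (Ideal.absNorm P : ℝ) ^ (-s)) =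
      (1 + (p : ℝ) ^ (-s)) ^ degreeOneCount K p := by
    intro p _
    rw [degreeOneCount, ← Finset.prod_const]
    refine Finset.prod_congr rfl fun P hP => ?_
    rw [(Finset.mem_filter.1 hP).2]
  rw [Finset.prod_congr rfl hinner] at hprod
  have hpos : ∀ p ∈ A, 0 < (1 + (p : ℝ) ^ (-s)) ^ degreeOneCount K p := fun p _ => by positivity
  have hlog := Real.log_le_log (Finset.prod_pos hpos) hprod
  rw [Real.log_prod fun p hp => (hpos p hp).ne'] at hlog
  have hterm : ∀ p ∈ A, (degreeOneCount K p : ℝ) * (p : ℝ) ^ (-s) ≤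
      Real.log ((1 + (p : ℝ) ^ (-s)) ^ degreeOneCount K p) +
        Module.finrank ℤ (𝓞 K) * ((p : ℝ)⁻¹) ^ 2 := by
    intro p hp
    have hp1 : (1 : ℝ) ≤ p := by exact_mod_cast (hAp p hp).one_le
    have hx := rpow_neg_le_inv_of_one_lt hp1 hs
    have hx0 : 0 < (p : ℝ) ^ (-s) := by positivity
    set x := (p : ℝ) ^ (-s)
    rw [Real.log_pow]
    have h1 : x - x ^ 2 ≤ Real.log (1 + x) := by
      refine le_trans ?_ (Real.one_sub_inv_le_log_of_pos (by linarith : 0 < 1 + x))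
      have : 1 - (1 + x)⁻¹ = x - x ^ 2 / (1 + x) := by field_simp; ring
      rw [this]
      have : x ^ 2 / (1 + x) ≤ x ^ 2 := div_le_self (by positivity) (by linarith)
      linarith
    have h2 : x ^ 2 ≤ ((p : ℝ)⁻¹) ^ 2 := by gcongr
    have h3 : (degreeOneCount K p : ℝ) ≤ Module.finrank ℤ (𝓞 K) := by
      exact_mod_cast degreeOneCount_le (hAp p hp)
    calc (degreeOneCount K p : ℝ) * x
        ≤ degreeOneCount K p * (Real.log (1 + x) + ((p : ℝ)⁻¹) ^ 2) := by gcongr; linarith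
      _ ≤ _ := by rw [mul_add]; gcongr
  calc _ ≤ _ := Finset.sum_le_sum hterm
    _ ≤ _ := by
      rw [Finset.sum_add_distrib, ← Finset.mul_sum]
      have := sum_primes_inv_sq_le n
      gcongr

theorem neg_log_one_sub_le {x : ℝ} (hx : x ≤ 1 / 2) :
    -Real.log (1 - x) ≤ x + 2 * x ^ 2 := by
  have h := Real.one_sub_inv_le_log_of_pos (by linarith : 0 < 1 - x)
  have h1 : (1 - x)⁻¹ ≤ 1 + x + 2 * x ^ 2 := by
    rw [inv_le_iff_one_le_mul₀ (by linarith)]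
    nlinarith [mul_nonneg (sq_nonneg x) (by linarith : 0 ≤ 1 - 2 * x)]
  linarith

theorem neg_log_one_sub_absNorm_rpow_le {s : ℝ} (hs : 1 < s) {p : ℕ} (hp : p.Prime)
    {P : Ideal (𝓞 K)} (hP : P ∈ primesAbove K p) :
    -Real.log (1 - (Ideal.absNorm P : ℝ) ^ (-s)) ≤
      (if Ideal.absNorm P = p then (p : ℝ) ^ (-s) else 0) + 2 * ((p : ℝ)⁻¹) ^ 2 := by
  have hp2 : (2 : ℝ) ≤ p := by exact_mod_cast hp.two_le
  have hinv : (p : ℝ)⁻¹ ≤ 1 / 2 := by rw [one_div]; gcongr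
  have hinv0 : 0 < (p : ℝ)⁻¹ := by positivity
  obtain ⟨-, -, f, hf, hN⟩ := exists_absNorm_eq_pow hp hP
  split_ifs with h
  · rw [h]
    have hx := rpow_neg_le_inv_of_one_lt (by linarith : (1 : ℝ) ≤ p) hs
    have hx0 : 0 ≤ (p : ℝ) ^ (-s) := by positivity
    refine (neg_log_one_sub_le (hx.trans hinv)).trans ?_
    gcongr
  · have hf2 : 2 ≤ f := by
      rcases hf.lt_or_eq with h' | h'
      · exact h'
      · rw [← h', pow_one] at hN
        exact absurd hN h
    have hN' : (Ideal.absNorm P : ℝ) = (p : ℝ) ^ f := by rw [hN]; push_cast; rfl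
    have hN1 : (1 : ℝ) ≤ Ideal.absNorm P := by
      rw [hN']; exact one_le_pow₀ (by linarith)
    have hx := rpow_neg_le_inv_of_one_lt hN1 hs
    have hx0 : 0 ≤ (Ideal.absNorm P : ℝ) ^ (-s) := by positivity
    have hx2 : (Ideal.absNorm P : ℝ)⁻¹ ≤ ((p : ℝ)⁻¹) ^ 2 := by
      rw [hN', inv_pow]
      gcongr
      linarith
    have hsq : ((p : ℝ)⁻¹) ^ 2 ≤ 1 / 4 := by nlinarith
    have := neg_log_one_sub_le (x := (Ideal.absNorm P : ℝ) ^ (-s)) (by linarith)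
    nlinarith

theorem log_sum_range_le_sum_degreeOneCount {s : ℝ} (hs : 1 < s) (n : ℕ)
    (hpos : 0 < ∑ m ∈ Finset.range (n + 1),
      (Nat.card {I : Ideal (𝓞 K) // Ideal.absNorm I = m} : ℝ) * (m : ℝ) ^ (-s)) :
    Real.log (∑ m ∈ Finset.range (n + 1),
      (Nat.card {I : Ideal (𝓞 K) // Ideal.absNorm I = m} : ℝ) * (m : ℝ) ^ (-s)) ≤
    ∑ p ∈ (Finset.Ioc 0 n).filter Nat.Prime, (degreeOneCount K p : ℝ) * (p : ℝ) ^ (-s) +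
      Module.finrank ℤ (𝓞 K) * (2 * ∑' m : ℕ, ((m : ℝ)⁻¹) ^ 2) := by
  set A := (Finset.Ioc 0 n).filter Nat.Prime with hA
  have hAp : ∀ p ∈ A, p.Prime := fun p hp => (Finset.mem_filter.1 hp).2
  set S := A.biUnion (primesAbove K) with hS
  have hSP : ∀ P ∈ S, P.IsPrime ∧ P ≠ ⊥ := by
    intro P hP
    obtain ⟨p, hp, hPp⟩ := Finset.mem_biUnion.1 hP
    obtain ⟨h1, h2, -⟩ := exists_absNorm_eq_pow (hAp p hp) hPp
    exact ⟨h1, h2⟩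
  set T := (Ideal.finite_setOfPred_absNorm_le (S := 𝓞 K) n).toFinset.filter (· ≠ ⊥) with hT
  have hmemT : ∀ I, I ∈ T ↔ Ideal.absNorm I ≤ n ∧ I ≠ ⊥ := by
    intro I
    simp [hT]
  have hle := sum_absNorm_rpow_le_prod (s := s) (by linarith) (T := T) hSP (by
    intro I hI
    obtain ⟨hIn, hI0⟩ := (hmemT I).1 hI
    refine ⟨hI0, fun P hP hP0 hPI => ?_⟩
    obtain ⟨p, hp, hpN, hPp⟩ := exists_mem_primesAbove hP hP0
    have hI0' : Ideal.absNorm I ≠ 0 := fun h => hI0 (Ideal.absNorm_eq_zero_iff.1 h)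
    have hpn : p ≤ n := (Nat.le_of_dvd (Nat.pos_of_ne_zero hI0')
      (hpN.trans (map_dvd Ideal.absNorm hPI))).trans hIn
    exact Finset.mem_biUnion.2
      ⟨p, Finset.mem_filter.2 ⟨Finset.mem_Ioc.2 ⟨hp.pos, hpn⟩, hp⟩, hPp⟩)
  have hsumT : ∑ m ∈ Finset.range (n + 1),
      (Nat.card {I : Ideal (𝓞 K) // Ideal.absNorm I = m} : ℝ) * (m : ℝ) ^ (-s) =
      ∑ I ∈ T, (Ideal.absNorm I : ℝ) ^ (-s) := by
    rw [← Finset.sum_fiberwise_of_maps_to (g := Ideal.absNorm) (t := Finset.range (n + 1))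
      (fun I hI => Finset.mem_range.2 (Nat.lt_succ_of_le ((hmemT I).1 hI).1))]
    refine Finset.sum_congr rfl fun m hm => ?_
    rcases Nat.eq_zero_or_pos m with rfl | hm0
    · rw [Nat.cast_zero, Real.zero_rpow (by linarith), mul_zero]
      symm
      refine Finset.sum_eq_zero fun I hI => ?_
      rw [(Finset.mem_filter.1 hI).2, Nat.cast_zero, Real.zero_rpow (by linarith)]
    · have hcard : Nat.card {I : Ideal (𝓞 K) // Ideal.absNorm I = m} =
          (T.filter (fun I => Ideal.absNorm I = m)).card := by
        rw [← Nat.card_eq_finsetCard]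
        refine Nat.card_congr (Equiv.subtypeEquivRight fun I => ?_)
        rw [Finset.mem_filter, hmemT]
        refine ⟨fun h => ⟨⟨?_, ?_⟩, h⟩, fun h => h.2⟩
        · rw [h]
          exact Nat.lt_succ_iff.1 (Finset.mem_range.1 hm)
        · rintro rfl
          rw [Ideal.absNorm_bot] at h
          omega
      rw [hcard, ← nsmul_eq_mul]
      symm
      refine Finset.sum_eq_card_nsmul fun I hI => ?_
      rw [(Finset.mem_filter.1 hI).2]
  rw [hsumT] at hpos ⊢
  have hdisj : (A : Set ℕ).PairwiseDisjoint (primesAbove K) :=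
    fun p hp q hq hpq => disjoint_primesAbove (hAp p hp) (hAp q hq) hpq
  have hlt : ∀ P ∈ S, (1 - (Ideal.absNorm P : ℝ) ^ (-s))⁻¹ ≠ 0 := by
    intro P hP
    refine inv_ne_zero (ne_of_gt (sub_pos.2 (Real.rpow_lt_one_of_one_lt_of_neg ?_ (by linarith))))
    have h0 : Ideal.absNorm P ≠ 0 := fun h => (hSP P hP).2 (Ideal.absNorm_eq_zero_iff.1 h)
    have h1 : Ideal.absNorm P ≠ 1 := fun h => (hSP P hP).1.ne_top (Ideal.absNorm_eq_one_iff.1 h)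
    exact_mod_cast (show 1 < Ideal.absNorm P by omega)
  refine (Real.log_le_log hpos hle).trans ?_
  rw [Real.log_prod hlt, Finset.sum_biUnion hdisj]
  have hterm : ∀ p ∈ A, ∑ P ∈ primesAbove K p, Real.log (1 - (Ideal.absNorm P : ℝ) ^ (-s))⁻¹ ≤
      (degreeOneCount K p : ℝ) * (p : ℝ) ^ (-s) +
        Module.finrank ℤ (𝓞 K) * (2 * ((p : ℝ)⁻¹) ^ 2) := by
    intro p hp
    have h1 : ∑ P ∈ primesAbove K p, Real.log (1 - (Ideal.absNorm P : ℝ) ^ (-s))⁻¹ ≤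
        ∑ P ∈ primesAbove K p, ((if Ideal.absNorm P = p then (p : ℝ) ^ (-s) else 0) +
          2 * ((p : ℝ)⁻¹) ^ 2) := by
      refine Finset.sum_le_sum fun P hP => ?_
      rw [Real.log_inv]
      exact neg_log_one_sub_absNorm_rpow_le hs (hAp p hp) hP
    refine h1.trans ?_
    rw [Finset.sum_add_distrib, ← Finset.sum_filter, Finset.sum_const, Finset.sum_const,
      nsmul_eq_mul, nsmul_eq_mul]
    have h2 : ((primesAbove K p).card : ℝ) ≤ Module.finrank ℤ (𝓞 K) := by
      exact_mod_cast card_primesAbove_le (hAp p hp)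
    unfold degreeOneCount
    gcongr
  refine (Finset.sum_le_sum hterm).trans ?_
  rw [Finset.sum_add_distrib, ← Finset.mul_sum, ← Finset.mul_sum]
  have := sum_primes_inv_sq_le n
  gcongr

theorem sum_degreeOneCount_div_sub_log_log_bounded : ∃ (A : ℝ) (N : ℕ), ∀ n ≥ N,
    |∑ p ∈ (Finset.Ioc 0 n).filter Nat.Prime, (degreeOneCount K p : ℝ) / p -
      Real.log (Real.log n)| ≤ A := by
  obtain ⟨δ, c, C, hδ, hc, hC, h⟩ := realZeta_bounds (K := K)
  set G : ℝ := ((Module.finrank ℤ (𝓞 K) : ℕ) : ℝ) with hG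
  set W : ℝ := ∑' m : ℕ, ((m : ℝ)⁻¹) ^ 2 with hW
  have hG0 : 0 ≤ G := by positivity
  have hW0 : 0 ≤ W := tsum_nonneg fun m => by positivity
  have hGW : 0 ≤ G * W := mul_nonneg hG0 hW0
  refine sum_primes_div_sub_log_log_bounded (G := G) (δ := δ)
    (C := |Real.log C| + |Real.log (c / 2)| + 2 * (G * W)) hδ (fun p => Nat.cast_nonneg _)
    (fun p hp => Nat.cast_le.2 (degreeOneCount_le hp)) ?_ ?_
  · intro s hs1 hs2 n
    obtain ⟨hsum, hlow, hup⟩ := h s hs1 hs2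
    have hs0 : 0 < s - 1 := by linarith
    have hpos : 0 < realZeta K s := lt_of_lt_of_le (by positivity) hlow
    have h1 := sum_degreeOneCount_le_log_realZeta hs1 hsum n
    have h2 := Real.log_le_log hpos hup
    rw [Real.log_div hC.ne' hs0.ne'] at h2
    linarith [le_abs_self (Real.log C), abs_nonneg (Real.log (c / 2))]
  · intro s hs1 hs2
    obtain ⟨hsum, hlow, hup⟩ := h s hs1 hs2
    have hs0 : 0 < s - 1 := by linarith
    have hpos : 0 < realZeta K s := lt_of_lt_of_le (by positivity) hlow
    have hev := hsum.hasSum.tendsto_sum_nat.eventually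
      (lt_mem_nhds (show realZeta K s / 2 < realZeta K s by linarith))
    obtain ⟨n₀, hn₀⟩ := Filter.eventually_atTop.1 hev
    refine ⟨n₀, fun n hn => ?_⟩
    have hlt := hn₀ (n + 1) (by omega)
    have h1 := log_sum_range_le_sum_degreeOneCount (K := K) hs1 n (by linarith)
    have hge : c / 2 / (s - 1) ≤ realZeta K s / 2 := by
      rw [div_right_comm]
      linarith
    have h2 := Real.log_le_log (by positivity) (hge.trans hlt.le)
    rw [Real.log_div (by positivity) hs0.ne'] at h2
    linarith [neg_abs_le (Real.log (c / 2)), abs_nonneg (Real.log C)]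

theorem exponent_ne_zero_of_adjoin_eq_top {θ : 𝓞 K}
    (hθ : Algebra.adjoin ℚ {(algebraMap (𝓞 K) K θ)} = ⊤) : RingOfIntegers.exponent θ ≠ 0 := by
  have hmul := conductor_mul_differentIdeal ℤ ℚ K θ hθ
  have hne : Polynomial.aeval θ (Polynomial.derivative (minpoly ℤ θ)) ≠ 0 := by
    intro h0
    have h1 := (Algebra.IsSeparable.isSeparable ℚ (algebraMap (𝓞 K) K θ)).aeval_derivative_ne_zero
      (minpoly.aeval ℚ (algebraMap (𝓞 K) K θ))
    rw [minpoly.isIntegrallyClosed_eq_field_fractions ℚ K θ.isIntegral,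
      Polynomial.derivative_map, Polynomial.aeval_map_algebraMap,
      Polynomial.aeval_algebraMap_apply, h0, map_zero] at h1
    exact h1 rfl
  have hcond : conductor ℤ θ ≠ ⊥ := by
    rintro h
    rw [h, Ideal.bot_mul] at hmul
    exact hne (Ideal.span_singleton_eq_bot.1 hmul.symm)
  rw [RingOfIntegers.exponent, Ne, Ideal.absNorm_eq_zero_iff]
  exact Ideal.under_ne_bot ℤ hcond

theorem polyRho_eq_card_roots_zmod (F : Polynomial ℤ) {p : ℕ} (hp : p.Prime) :
    polyRho F p = Nat.card {x : ZMod p // F.eval₂ (Int.castRingHom (ZMod p)) x = 0} := by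
  have : NeZero p := ⟨hp.ne_zero⟩
  have hev : ∀ n : ℕ, F.eval₂ (Int.castRingHom (ZMod p)) (n : ZMod p) = 0 ↔
      (p : ℤ) ∣ F.eval (n : ℤ) := by
    intro n
    rw [← ZMod.intCast_zmod_eq_zero_iff_dvd]
    have : F.eval₂ (Int.castRingHom (ZMod p)) ((Int.castRingHom (ZMod p)) (n : ℤ)) =
      (Int.castRingHom (ZMod p)) (F.eval (n : ℤ)) := Polynomial.eval₂_at_apply _ _
    simp only [eq_intCast, Int.cast_natCast] at this
    rw [this]
  rw [polyRho_eq_card_filter, ← Nat.card_eq_finsetCard]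
  refine Nat.card_congr (Equiv.ofBijective
    (fun n => ⟨(n.1 : ZMod p), (hev n.1).2 (Finset.mem_filter.1 n.2).2⟩) ⟨?_, ?_⟩)
  · rintro ⟨m, hm⟩ ⟨n, hn⟩ h
    have h' : (m : ZMod p) = n := congrArg Subtype.val h
    rw [ZMod.natCast_eq_natCast_iff'] at h'
    rw [Nat.mod_eq_of_lt (Finset.mem_range.1 (Finset.mem_filter.1 hm).1),
      Nat.mod_eq_of_lt (Finset.mem_range.1 (Finset.mem_filter.1 hn).1)] at h'
    exact Subtype.ext h'
  · rintro ⟨x, hx⟩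
    refine ⟨⟨x.val, Finset.mem_filter.2 ⟨Finset.mem_range.2 (ZMod.val_lt x), ?_⟩⟩, ?_⟩
    · rw [← hev, ZMod.natCast_zmod_val]
      exact hx
    · exact Subtype.ext (ZMod.natCast_zmod_val x)

theorem polyRho_integralNormalization {F : Polynomial ℤ} (hF : 1 ≤ F.natDegree) {p : ℕ}
    (hp : p.Prime) (hlc : ¬ (p : ℤ) ∣ F.leadingCoeff) :
    polyRho F.integralNormalization p = polyRho F p := by
  have := Fact.mk hp
  rw [polyRho_eq_card_roots_zmod _ hp, polyRho_eq_card_roots_zmod _ hp]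
  have hu : (Int.castRingHom (ZMod p)) F.leadingCoeff ≠ 0 := by
    rw [eq_intCast, Ne, ZMod.intCast_zmod_eq_zero_iff_dvd]
    exact hlc
  refine (Nat.card_congr ((Equiv.mulLeft₀ _ hu).subtypeEquiv fun x => ?_)).symm
  rw [Equiv.mulLeft₀_apply, Polynomial.integralNormalization_eval₂_leadingCoeff_mul hF]
  exact (mul_eq_zero_iff_left (pow_ne_zero _ hu)).symm

theorem degreeOneCount_eq_polyRho_minpoly {θ : 𝓞 K} {p : ℕ} (hp : p.Prime)
    (hpθ : ¬ p ∣ RingOfIntegers.exponent θ) :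
    degreeOneCount K p = polyRho (minpoly ℤ θ) p := by
  have := Fact.mk hp
  rw [polyRho_eq_card_roots_zmod _ hp, degreeOneCount, ← Nat.card_eq_finsetCard]
  set e := NumberField.Ideal.primesOverSpanEquivMonicFactorsMod hpθ with he
  have hmp : ((minpoly ℤ θ).map (Int.castRingHom (ZMod p))) ≠ 0 :=
    Polynomial.map_monic_ne_zero (minpoly.monic θ.isIntegral)
  have hmemX : ∀ x : ZMod p, Polynomial.X - Polynomial.C x ∈ RingOfIntegers.monicFactorsMod θ p ↔
      (minpoly ℤ θ).eval₂ (Int.castRingHom (ZMod p)) x = 0 := by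
    intro x
    rw [Multiset.mem_toFinset, Polynomial.mem_normalizedFactors_iff hmp,
      Polynomial.dvd_iff_isRoot, Polynomial.IsRoot.def, Polynomial.eval_map]
    exact ⟨fun h => h.2.2,
      fun h => ⟨Polynomial.irreducible_X_sub_C x, Polynomial.monic_X_sub_C x, h⟩⟩
  have hnorm : ∀ (Q : (Polynomial (ZMod p))) (hQ : Q ∈ RingOfIntegers.monicFactorsMod θ p),
      Ideal.absNorm (e.symm ⟨Q, hQ⟩ : Ideal (𝓞 K)) = p ^ Q.natDegree := by
    intro Q hQ
    rw [← NumberField.Ideal.inertiaDeg_primesOverSpanEquivMonicFactorsMod_symm_apply' hpθ hQ]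
    have h1 := (e.symm ⟨Q, hQ⟩).2.1
    have h2 := (e.symm ⟨Q, hQ⟩).2.2
    exact (Ideal.pow_inertiaDeg p (e.symm ⟨Q, hQ⟩ : Ideal (𝓞 K))).symm
  symm
  refine Nat.card_congr (Equiv.ofBijective
    (fun x => ⟨(e.symm ⟨Polynomial.X - Polynomial.C x.1, (hmemX x.1).2 x.2⟩ : Ideal (𝓞 K)),
      Finset.mem_filter.2 ⟨(mem_primesAbove hp).2 (e.symm _).2, ?_⟩⟩) ⟨?_, ?_⟩)
  · rw [hnorm, Polynomial.natDegree_X_sub_C, pow_one]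
  · rintro ⟨x, hx⟩ ⟨y, hy⟩ h
    have hval := congrArg Subtype.val h
    have h0 : (e.symm ⟨Polynomial.X - Polynomial.C x, (hmemX x).2 hx⟩ : Ideal (𝓞 K)) =
        e.symm ⟨Polynomial.X - Polynomial.C y, (hmemX y).2 hy⟩ := hval
    have h1 := congrArg Subtype.val (e.symm.injective (Subtype.ext h0))
    exact Subtype.ext (Polynomial.C_injective (sub_right_injective h1))
  · rintro ⟨P, hP⟩
    obtain ⟨hPp, hPN⟩ := Finset.mem_filter.1 hP
    obtain ⟨⟨Q, hQ⟩, hQP⟩ := e.symm.surjective ⟨P, (mem_primesAbove hp).1 hPp⟩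
    have hd := hnorm Q hQ
    rw [hQP] at hd
    have hd1 : Q.natDegree = 1 := by
      refine Nat.pow_right_injective hp.two_le ?_
      simp only [pow_one]
      rw [← hd]
      exact hPN
    have hmon : Q.Monic := ((Polynomial.mem_normalizedFactors_iff hmp).1
      (Multiset.mem_toFinset.1 hQ)).2.1
    obtain ⟨x, rfl⟩ : ∃ x, Q = Polynomial.X - Polynomial.C x := by
      refine ⟨-Q.coeff 0, ?_⟩
      rw [map_neg, sub_neg_eq_add]
      exact hmon.eq_X_add_C hd1
    have h0 : (e.symm ⟨_, hQ⟩ : Ideal (𝓞 K)) = P := congrArg Subtype.val hQP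
    exact ⟨⟨x, (hmemX x).1 hQ⟩, Subtype.ext h0⟩

theorem exists_degreeOneCount_eq_polyRho {F : Polynomial ℤ} (hF : Irreducible F)
    (hdeg : 1 ≤ F.natDegree) (hroot : ∃ α : K, Polynomial.aeval α F = 0 ∧ Algebra.adjoin ℚ {α} = ⊤)
    (hrank : Module.finrank ℚ K = F.natDegree) :
    ∃ B : ℕ, ∀ p : ℕ, p.Prime → B < p → degreeOneCount K p = polyRho F p := by
  obtain ⟨α, hα, htop⟩ := hroot
  have hlc : F.leadingCoeff ≠ 0 := Polynomial.leadingCoeff_ne_zero.2 hF.ne_zero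
  have hlcQ : (F.leadingCoeff : ℚ) ≠ 0 := by exact_mod_cast hlc
  have hval : Polynomial.aeval (algebraMap ℤ K F.leadingCoeff * α) F.integralNormalization = 0 :=
    Polynomial.integralNormalization_aeval_eq_zero hα
      (fun x hx => by simpa using hx)
  have hmonic := Polynomial.monic_integralNormalization hF.ne_zero
  have hint : IsIntegral ℤ (algebraMap ℤ K F.leadingCoeff * α) :=
    ⟨_, hmonic, hval⟩
  obtain ⟨θ, hθ⟩ : ∃ θ : 𝓞 K, algebraMap (𝓞 K) K θ = algebraMap ℤ K F.leadingCoeff * α :=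
    ⟨⟨_, hint⟩, rfl⟩
  have hadj : Algebra.adjoin ℚ {algebraMap (𝓞 K) K θ} = ⊤ := by
    rw [eq_top_iff, ← htop]
    refine Algebra.adjoin_le (Set.singleton_subset_iff.2 ?_)
    have h1 : α = (F.leadingCoeff : ℚ)⁻¹ • algebraMap (𝓞 K) K θ := by
      rw [hθ, Algebra.smul_def, map_inv₀]
      simp [hlc]
    rw [h1]
    exact Subalgebra.smul_mem _ (Algebra.subset_adjoin (Set.mem_singleton _)) _
  have hmin : minpoly ℤ θ = F.integralNormalization := by
    have hdvd : minpoly ℤ θ ∣ F.integralNormalization := by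
      refine minpoly.isIntegrallyClosed_dvd θ.isIntegral ?_
      apply FaithfulSMul.algebraMap_injective (𝓞 K) K
      rw [← Polynomial.aeval_algebraMap_apply, hθ, hval, map_zero]
    refine (Polynomial.eq_of_monic_of_dvd_of_natDegree_le (minpoly.monic θ.isIntegral) hmonic
      hdvd ?_).symm
    have h1 : (minpoly ℚ (algebraMap (𝓞 K) K θ)).natDegree = Module.finrank ℚ K := by
      refine (Field.primitive_element_iff_minpoly_natDegree_eq ℚ _).1 ?_
      rw [← IntermediateField.toSubalgebra_inj,
        IntermediateField.adjoin_simple_toSubalgebra_of_isAlgebraic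
          (Algebra.IsAlgebraic.isAlgebraic _), hadj, IntermediateField.top_toSubalgebra]
    rw [minpoly.isIntegrallyClosed_eq_field_fractions ℚ K θ.isIntegral,
      (minpoly.monic θ.isIntegral).natDegree_map, hrank] at h1
    rw [h1, Polynomial.natDegree_integralNormalization]
  refine ⟨max (RingOfIntegers.exponent θ) F.leadingCoeff.natAbs, fun p hp hB => ?_⟩
  have hpe : ¬ p ∣ RingOfIntegers.exponent θ := fun h => by
    have := Nat.le_of_dvd (Nat.pos_of_ne_zero (exponent_ne_zero_of_adjoin_eq_top hadj)) h
    omega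
  have hpl : ¬ (p : ℤ) ∣ F.leadingCoeff := fun h => by
    have := Nat.le_of_dvd (Int.natAbs_pos.2 hlc) (Int.natCast_dvd.1 h)
    omega
  rw [degreeOneCount_eq_polyRho_minpoly hp hpe, hmin, polyRho_integralNormalization hdeg hp hpl]

end NumberField

theorem sum_polyRho_div_sub_log_log_bounded {F : Polynomial ℤ} (hF : Irreducible F)
    (hdeg : 1 ≤ F.natDegree) :
    ∃ G : ℝ, (∀ p : ℕ, p.Prime → (polyRho F p : ℝ) ≤ G) ∧ ∃ (A : ℝ) (N : ℕ), ∀ n ≥ N,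
      |∑ p ∈ (Finset.Ioc 0 n).filter Nat.Prime, (polyRho F p : ℝ) / p -
        Real.log (Real.log n)| ≤ A := by
  set f : Polynomial ℚ := F.map (Int.castRingHom ℚ) with hf
  have hirr : Irreducible f :=
    (Polynomial.IsPrimitive.Int.irreducible_iff_irreducible_map_cast
      (hF.isPrimitive (by omega))).1 hF
  have : Fact (Irreducible f) := ⟨hirr⟩
  have hfd : f.natDegree = F.natDegree :=
    Polynomial.natDegree_map_eq_of_injective (Int.castRingHom ℚ).injective_int F
  set pb := AdjoinRoot.powerBasis hirr.ne_zero with hpb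
  have : CharZero (AdjoinRoot f) := algebraRat.charZero _
  have : FiniteDimensional ℚ (AdjoinRoot f) := pb.finite
  have : NumberField (AdjoinRoot f) := ⟨⟩
  obtain ⟨B, hB⟩ := exists_degreeOneCount_eq_polyRho (K := AdjoinRoot f) hF hdeg
    ⟨AdjoinRoot.root f, by
      have h := AdjoinRoot.eval₂_root f
      rw [hf, Polynomial.eval₂_map] at h
      exact (congrArg (fun φ => F.eval₂ φ (AdjoinRoot.root f)) (RingHom.ext_int _ _)).trans h,
        AdjoinRoot.adjoinRoot_eq_top⟩ (by rw [pb.finrank, ← hfd]; rfl)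
  obtain ⟨A, N, hA⟩ := sum_degreeOneCount_div_sub_log_log_bounded (K := AdjoinRoot f)
  set d : ℕ → ℝ := fun p => degreeOneCount (AdjoinRoot f) p with hd
  refine ⟨Module.finrank ℤ (NumberField.RingOfIntegers (AdjoinRoot f)) + B, fun p hp => ?_,
    |∑ p ∈ (Finset.Ioc 0 B).filter Nat.Prime, ((polyRho F p : ℝ) / p - d p / p)| + A,
    max N B, fun n hn => ?_⟩
  · rcases le_or_gt p B with h | h
    · have h1 : polyRho F p ≤ p := by
        rw [polyRho_eq_card_filter]
        simpa using Finset.card_filter_le (Finset.range p) (fun n => (p : ℤ) ∣ F.eval (n : ℤ))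
      have h2 : (polyRho F p : ℝ) ≤ B := by exact_mod_cast h1.trans h
      have h3 : (0 : ℝ) ≤ Module.finrank ℤ (NumberField.RingOfIntegers (AdjoinRoot f)) :=
        Nat.cast_nonneg _
      linarith
    · rw [← hB p hp h]
      have h2 : (degreeOneCount (AdjoinRoot f) p : ℝ) ≤
          Module.finrank ℤ (NumberField.RingOfIntegers (AdjoinRoot f)) :=
        Nat.cast_le.2 (degreeOneCount_le hp)
      have h3 : (0 : ℝ) ≤ B := Nat.cast_nonneg _
      linarith
  · have hnB : B ≤ n := (le_max_right _ _).trans hn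
    have hdiff : ∑ p ∈ (Finset.Ioc 0 n).filter Nat.Prime, (polyRho F p : ℝ) / p -
        ∑ p ∈ (Finset.Ioc 0 n).filter Nat.Prime, d p / p =
        ∑ p ∈ (Finset.Ioc 0 B).filter Nat.Prime, ((polyRho F p : ℝ) / p - d p / p) := by
      rw [← Finset.sum_sub_distrib]
      symm
      refine Finset.sum_subset
        (Finset.filter_subset_filter _ (Finset.Ioc_subset_Ioc_right hnB)) fun p hp hpB => ?_
      obtain ⟨hpn, hpp⟩ := Finset.mem_filter.1 hp
      have hBp : B < p := by
        by_contra! hle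
        exact hpB (Finset.mem_filter.2 ⟨Finset.mem_Ioc.2 ⟨hpp.pos, hle⟩, hpp⟩)
      rw [hd]
      simp only
      rw [hB p hpp hBp, sub_self]
    have h1 := hA n ((le_max_left _ _).trans hn)
    rw [← hdiff]
    refine le_trans (le_of_eq ?_) ((abs_add_le _ _).trans (add_le_add le_rfl h1))
    congr 1
    ring

theorem stmt8 (F : Polynomial ℤ) (hF : Irreducible F) (hdeg : 2 ≤ F.natDegree) :
    ∃ (D : ℕ) (c₅ : ℝ) (lam : ℕ → ℕ), 2 ≤ D ∧ 0 < c₅ ∧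
      (∀ p : ℕ, p.Prime → D < p → (polyRho F p : ℝ) / p ≤ Real.log 2) ∧
      lam 0 = D ∧
      (∀ j : ℕ, 1 ≤ j →
        ((lam j).Prime ∧ lam (j - 1) < lam j ∧
          ∑ p ∈ (Finset.Ioc (lam (j - 1)) (lam j)).filter Nat.Prime,
              (polyRho F p : ℝ) / p ≤ Real.log 2) ∧
        (∀ q : ℕ, q.Prime → lam (j - 1) < q →
          (∑ p ∈ (Finset.Ioc (lam (j - 1)) q).filter Nat.Prime,
              (polyRho F p : ℝ) / p ≤ Real.log 2) → q ≤ lam j)) ∧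
      ∀ j : ℕ, (2 : ℝ) ^ ((j : ℝ) - c₅) ≤ Real.log (lam j) ∧
        Real.log (lam j) ≤ (2 : ℝ) ^ ((j : ℝ) + c₅) := by
  obtain ⟨G, hG, A, N, hA⟩ := sum_polyRho_div_sub_log_log_bounded hF (by omega)
  exact exists_seq_of_sum_primes_div (r := fun p => (polyRho F p : ℝ))
    (fun p => Nat.cast_nonneg _) hG hA
end
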